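/- arXiv:2004.10494 — 2 statements merged into one kernel-verified Lean document; each statement's English description precedes it below -/
import Mathlib

section
/- Let G be a finite solvable group, let H be a maximal subgroup of G with |G : H| = p^a, where p is a prime with p ≥ 5 and a is a positive integer, and let K be a subgroup of G isomorphic to H (as abstract groups). Then K is a maximal subgroup of G. (Remark 2.5) -/
open Pointwise
open scoped commutatorElement

theorem exists_fixed_ne_one_of_dvd_card {q : ℕ} (hq : q.Prime) {P Y : Type*} [Group P] [Group Y]
    (hP : IsPGroup q P) (φ : P →* MulAut Y) (D : Subgroup Y) [Finite D]
    (hD : ∀ g : P, ∀ d ∈ D, φ g d ∈ D) (hdvd : q ∣ Nat.card D) :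
    ∃ t ∈ D, t ≠ 1 ∧ ∀ g : P, φ g t = t := by
  have := Fact.mk hq
  let _ : MulAction P D :=
    { smul := fun g d => ⟨φ g d, hD g d d.2⟩
      one_smul := fun d => Subtype.ext (by change φ 1 d = d; simp)
      mul_smul := fun g h d => Subtype.ext (by change φ (g * h) d = φ g (φ h d); simp) }
  have h1 : (1 : D) ∈ MulAction.fixedPoints P D := fun g => Subtype.ext (map_one (φ g))
  obtain ⟨t, ht, hne⟩ := hP.exists_fixed_point_of_prime_dvd_card_of_fixed_point D hdvd h1
  exact ⟨t, t.2, fun h => hne (Subtype.ext h.symm), fun g => congrArg Subtype.val (ht g)⟩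

theorem eq_one_of_pow_eq_one_of_coprime {Y : Type*} [Group Y] {m n : ℕ} (h : m.Coprime n) {y : Y}
    (hm : y ^ m = 1) (hn : y ^ n = 1) : y = 1 := by
  have := Nat.dvd_gcd (orderOf_dvd_of_pow_eq_one hm) (orderOf_dvd_of_pow_eq_one hn)
  rw [h] at this
  exact orderOf_eq_one_iff.mp (Nat.dvd_one.mp this)

theorem mulAut_pow_apply_of_apply_eq_mul {Y : Type*} [CommGroup Y] {u : MulAut Y} {t w : Y}
    (ht : u t = t) (hw : u w = t * w) (n : ℕ) : (u ^ n) w = t ^ n * w := by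
  induction n with
  | zero => simp
  | succ n ih =>
    rw [pow_succ', MulAut.mul_apply, ih, map_mul, map_pow, ht, hw, pow_succ, mul_assoc]

theorem mulAut_eq_one_of_trivial_on_series {Y : Type*} [CommGroup Y] {r n : ℕ} (hrn : r.Coprime n)
    (hY : ∀ y : Y, y ^ r = 1) {u : MulAut Y} (hu : u ^ n = 1) (V : Subgroup Y)
    (hV : ∀ v ∈ V, u v = v) (hquot : ∀ y, u y * y⁻¹ ∈ V) : u = 1 := by
  ext y
  have h := mulAut_pow_apply_of_apply_eq_mul (hV _ (hquot y)) (w := y) (by group) n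
  rw [hu, MulAut.one_apply, eq_comm, mul_eq_right] at h
  have := eq_one_of_pow_eq_one_of_coprime hrn (hY _) h
  rw [mul_inv_eq_one] at this
  simpa using this

theorem mulAut_eq_one_of_trivial_on_fixed {Y : Type*} [CommGroup Y] [Finite Y] {r n : ℕ}
    (hr : r.Prime) (hrn : r.Coprime n) (hY : ∀ y : Y, y ^ r = 1) {u : MulAut Y} (hu : u ^ n = 1)
    {B : Subgroup (MulAut Y)} (hB : IsPGroup r B) (hcomm : ∀ b ∈ B, u * b = b * u)
    (hfix : ∀ y, (∀ b ∈ B, b y = y) → u y = y) : u = 1 := by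
  let δ : Y →* Y := u.toMonoidHom / MonoidHom.id Y
  have hδ : ∀ y, δ y = u y * y⁻¹ := fun y => div_eq_mul_inv _ _
  by_cases htriv : δ.range = ⊥
  · ext y
    have : δ y ∈ δ.range := ⟨y, rfl⟩
    rw [htriv, Subgroup.mem_bot, hδ, mul_inv_eq_one] at this
    simpa using this
  exfalso
  have := Fact.mk hr
  have hP : IsPGroup r δ.range := fun y => ⟨1, Subtype.ext (by simpa using hY y)⟩
  have : Nontrivial δ.range := (Subgroup.nontrivial_iff_ne_bot _).mpr htriv
  have hdvd : r ∣ Nat.card δ.range := by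
    obtain ⟨k, hk, he⟩ := hP.nontrivial_iff_card.mp inferInstance
    rw [he]
    exact dvd_pow_self r hk.ne'
  obtain ⟨t, ⟨w, rfl⟩, hne, hfixt⟩ := exists_fixed_ne_one_of_dvd_card hr hB B.subtype δ.range
    (by
      rintro ⟨b, hb⟩ _ ⟨y, rfl⟩
      refine ⟨b y, ?_⟩
      have := DFunLike.congr_fun (hcomm b hb) y
      simp only [MulAut.mul_apply] at this
      simp [hδ, this]) hdvd
  have hut : u (δ w) = δ w := hfix _ fun b hb => hfixt ⟨b, hb⟩
  have h := mulAut_pow_apply_of_apply_eq_mul hut (w := w) (by rw [hδ]; group) n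
  rw [hu, MulAut.one_apply, eq_comm, mul_eq_right] at h
  exact hne (eq_one_of_pow_eq_one_of_coprime hrn (hY _) h)

/-- The subgroup of elements fixed by an automorphism. -/
def fixedSubgroup {Y : Type*} [Group Y] (x : MulAut Y) : Subgroup Y :=
  MonoidHom.eqLocus x.toMonoidHom (MonoidHom.id Y)

theorem mem_fixedSubgroup {Y : Type*} [Group Y] {x : MulAut Y} {y : Y} :
    y ∈ fixedSubgroup x ↔ x y = y := Iff.rfl

theorem smul_fixedSubgroup {Y : Type*} [Group Y] (h x : MulAut Y) :
    h • fixedSubgroup x = fixedSubgroup (h * x * h⁻¹) := by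
  ext y
  rw [Subgroup.mem_pointwise_smul_iff_inv_smul_mem, mem_fixedSubgroup, mem_fixedSubgroup]
  simp only [MulAut.smul_def, MulAut.mul_apply]
  constructor
  · intro h1
    rw [h1]
    simp
  · intro h1
    apply h.injective
    rw [h1]
    simp

/-- An automorphism of order `r` whose fixed points have index at most `r` acts trivially
modulo its fixed points. -/
theorem apply_mul_inv_mem_fixedSubgroup {Y : Type*} [CommGroup Y] [Finite Y] {r : ℕ}
    (hr : r.Prime) (hY : ∀ y : Y, y ^ r = 1) {x : MulAut Y} (hx : x ^ r = 1)
    (hcard : (fixedSubgroup x).index ≤ r) (y : Y) : x y * y⁻¹ ∈ fixedSubgroup x := by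
  let δ : Y →* Y := x.toMonoidHom / MonoidHom.id Y
  have hδ : ∀ y, δ y = x y * y⁻¹ := fun y => div_eq_mul_inv _ _
  have hker : δ.ker = fixedSubgroup x := by
    ext y
    rw [MonoidHom.mem_ker, hδ, mul_inv_eq_one, mem_fixedSubgroup]
  have := Fact.mk hr
  have hP : IsPGroup r δ.range := fun y => ⟨1, Subtype.ext (by simpa using hY y)⟩
  have hP' : IsPGroup r (Subgroup.zpowers x) := by
    rintro ⟨_, n, rfl⟩
    refine ⟨1, Subtype.ext ?_⟩
    simp only [pow_one, SubgroupClass.coe_pow, OneMemClass.coe_one]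
    rw [← zpow_natCast, ← zpow_mul, mul_comm, zpow_mul, zpow_natCast, hx, one_zpow]
  have hcard' : Nat.card δ.range ≤ r := by
    rw [← Subgroup.index_ker, hker]; exact hcard
  rw [← hδ]
  have hmem : δ y ∈ δ.range := ⟨y, rfl⟩
  obtain ⟨n, hn⟩ := hP.exists_card_eq
  rcases Nat.eq_zero_or_pos n with rfl | hpos
  · rw [pow_zero, Subgroup.card_eq_one] at hn
    rw [hn, Subgroup.mem_bot] at hmem
    rw [hmem]
    exact one_mem _
  have hr' : Nat.card δ.range = r :=
    le_antisymm hcard' (Nat.le_of_dvd Nat.card_pos (hn ▸ dvd_pow_self r hpos.ne'))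
  obtain ⟨t, ht, hne, hfix⟩ := exists_fixed_ne_one_of_dvd_card hr hP' (Subgroup.zpowers x).subtype
    δ.range (by
      rintro ⟨_, n, rfl⟩ _ ⟨w, rfl⟩
      refine ⟨(x ^ n) w, ?_⟩
      have hc : x * x ^ n = x ^ n * x := (Commute.self_zpow x n).eq
      have := DFunLike.congr_fun hc w
      simp only [MulAut.mul_apply] at this
      simp [hδ, this]) (by rw [hr'])
  have htx : t ∈ fixedSubgroup x := hfix ⟨x, Subgroup.mem_zpowers x⟩
  have hle : δ.range = Subgroup.zpowers t := by
    symm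
    apply Subgroup.eq_of_le_of_card_ge
    · exact (Subgroup.zpowers_le).mpr ht
    · rw [hr', Nat.card_zpowers, orderOf_eq_prime (hY t) hne]
  rw [hle] at hmem
  exact (Subgroup.zpowers_le.mpr htx) hmem

/-- `n` distinct subgroups of index `r` in a group of exponent `r`, pairwise meeting in the
same subgroup. -/
theorem card_le_of_pairwise_inf_eq {Y : Type*} [Group Y] [Finite Y] {r m c : ℕ} (hr : 1 < r)
    (S : Set (Subgroup Y)) (C : Subgroup Y)
    (hY : Nat.card Y = r * m) (hm : m = r * c) (hC : Nat.card C = c)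
    (hcard : ∀ V ∈ S, Nat.card V = m) (hCV : ∀ V ∈ S, C ≤ V)
    (hpair : ∀ V ∈ S, ∀ V' ∈ S, V ≠ V' → V ⊓ V' ≤ C) : Nat.card S ≤ r + 1 := by
  have := Fintype.ofFinite S
  let f : (Σ V : S, ((V : Subgroup Y) : Set Y) \ (C : Set Y) |>.Elem) → ((C : Set Y)ᶜ : Set Y) :=
    fun z => ⟨z.2.1, z.2.2.2⟩
  have hf : Function.Injective f := by
    rintro ⟨⟨V, hV⟩, ⟨v, hv, hvC⟩⟩ ⟨⟨V', hV'⟩, ⟨v', hv', hvC'⟩⟩ h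
    obtain rfl : v = v' := congrArg Subtype.val h
    obtain rfl : V = V' := by
      by_contra hne
      exact hvC (hpair V hV V' hV' hne ⟨hv, hv'⟩)
    rfl
  have h1 := Nat.card_le_card_of_injective f hf
  have h2 : ∀ V : S, Nat.card (((V : Subgroup Y) : Set Y) \ (C : Set Y) |>.Elem) = m - c := by
    intro V
    rw [Nat.card_coe_set_eq, Set.ncard_sdiff (hCV V V.2)]
    rw [← Nat.card_coe_set_eq, ← Nat.card_coe_set_eq]
    exact congrArg₂ _ (hcard V V.2) hC
  rw [Nat.card_sigma, Finset.sum_congr rfl (fun V _ => h2 V), Finset.sum_const, smul_eq_mul,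
    Finset.card_univ, ← Nat.card_eq_fintype_card, Nat.card_coe_set_eq (C : Set Y)ᶜ, Set.ncard_compl,
    ← Nat.card_coe_set_eq, hY] at h1
  have hc : Nat.card (C : Set Y) = c := hC
  have hcpos : 0 < c := hC ▸ Nat.card_pos
  rw [hc, hm] at h1
  obtain ⟨s, rfl⟩ : ∃ s, r = s + 2 := ⟨r - 2, by omega⟩
  have e1 : (s + 2) * c - c = (s + 1) * c := by
    rw [show (s + 2) * c = (s + 1) * c + c by ring]; omega
  have e2 : (s + 2) * ((s + 2) * c) - c = (s + 3) * ((s + 1) * c) := by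
    rw [show (s + 2) * ((s + 2) * c) = (s + 3) * ((s + 1) * c) + c by ring]; omega
  rw [e1, e2] at h1
  exact Nat.le_of_mul_le_mul_right h1 (by positivity)

theorem card_inf_mul_card_of_index_prime {Y : Type*} [CommGroup Y] [Finite Y] {r : ℕ}
    (hr : r.Prime) {V W : Subgroup Y} (hV : V.index = r) (hW : W.index = r) (hne : V ≠ W) :
    Nat.card Y = r * (r * Nat.card (V ⊓ W : Subgroup Y)) := by
  have h1 : (V ⊓ W).index = W.relIndex V * V.index := by
    rw [← Subgroup.inf_relIndex_left V W, Subgroup.relIndex_mul_index inf_le_left]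
  have h2 : W.relIndex V = r := by
    have hd : W.relIndex V ∣ r := hW ▸ Subgroup.relIndex_dvd_index_of_normal W V
    rcases (Nat.dvd_prime hr).mp hd with h | h
    · exfalso
      have hle := Subgroup.relIndex_eq_one.mp h
      apply hne
      apply Subgroup.eq_of_le_of_card_ge hle
      have e1 := V.card_mul_index
      have e2 := W.card_mul_index
      rw [hV] at e1
      rw [hW] at e2
      exact (Nat.eq_of_mul_eq_mul_right hr.pos (e2.trans e1.symm)).le
    · exact h
  have h3 := (V ⊓ W).card_mul_index
  rw [h1, h2, hV] at h3
  rw [← h3]; ring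

/-- If `x` of prime order `r` normalises a `p`-subgroup `R` of automorphisms of an elementary
abelian `r`-group, where `5 ≤ p` and the fixed points of `x` have index at most `r`, then `x`
centralises `R`. -/
theorem commute_of_index_fixedSubgroup_le {Y : Type*} [CommGroup Y] [Finite Y] {p r : ℕ}
    (hp : p.Prime) (hp5 : 5 ≤ p) (hr : r.Prime) (hpr : r ≠ p) (hY : ∀ y : Y, y ^ r = 1)
    {x : MulAut Y} (hx : x ^ r = 1) {R : Subgroup (MulAut Y)} (hR : IsPGroup p R)
    (hnorm : ∀ g ∈ R, x * g * x⁻¹ ∈ R) (hcard : (fixedSubgroup x).index ≤ r) :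
    ∀ g ∈ R, x * g = g * x := by
  have := Fact.mk hp
  have := Fact.mk hr
  set W := fixedSubgroup x with hW
  have hcop : ∀ k, r.Coprime (p ^ k) := fun k =>
    Nat.Coprime.pow_right k ((Nat.coprime_primes hr hp).mpr hpr)
  have hT := apply_mul_inv_mem_fixedSubgroup hr hY hx hcard
  have hpow : ∀ u ∈ R, ∃ k, u ^ p ^ k = 1 := fun u hu => by
    obtain ⟨k, hk⟩ := hR ⟨u, hu⟩
    exact ⟨k, by simpa using congrArg Subtype.val hk⟩
  have hser : ∀ u ∈ R, ∀ V : Subgroup Y, (∀ v ∈ V, u v = v) → (∀ y, u y * y⁻¹ ∈ V) → u = 1 := by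
    intro u hu V h1 h2
    obtain ⟨k, hk⟩ := hpow u hu
    exact mulAut_eq_one_of_trivial_on_series (hcop k) hY hk V h1 h2
  -- elements of `R` that stabilise the fixed points of `x` commute with `x`
  have hα : ∀ g ∈ R, g • W = W → x * g = g * x := by
    intro g hg hgW
    have hgW' : g⁻¹ • W = W := by rw [inv_smul_eq_iff, hgW]
    have hmem : ∀ w ∈ W, g w ∈ W := fun w hw => by
      rw [← hgW]; exact Subgroup.smul_mem_pointwise_smul w g W hw
    have hmem' : ∀ w ∈ W, g⁻¹ w ∈ W := fun w hw => by
      have h1 := Subgroup.smul_mem_pointwise_smul w g⁻¹ W hw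
      rwa [hgW'] at h1
    have hu : x * g * x⁻¹ * g⁻¹ ∈ R := R.mul_mem (hnorm g hg) (R.inv_mem hg)
    have hxinv : ∀ w ∈ W, x⁻¹ w = w := fun w hw => by
      apply x.injective
      rw [mem_fixedSubgroup.mp hw]
      simp
    have h1 := hser _ hu W (by
      intro w hw
      simp only [MulAut.mul_apply]
      rw [hxinv _ (hmem' w hw), MulAut.apply_inv_self, mem_fixedSubgroup.mp hw]) (by
      intro y
      obtain ⟨z, rfl⟩ : ∃ z, y = g (x z) := ⟨x⁻¹ (g⁻¹ y), by simp⟩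
      simp only [MulAut.mul_apply, MulAut.inv_apply_self]
      have e : x (g z) * (g (x z))⁻¹ = (x (g z) * (g z)⁻¹) * (g (x z * z⁻¹))⁻¹ := by
        simp only [map_mul, map_inv]
        group
      rw [e]
      exact W.mul_mem (hT _) (W.inv_mem (hmem _ (hT _))))
    rwa [mul_inv_eq_one, mul_inv_eq_iff_eq_mul] at h1
  have hstab : ∀ g, x * g = g * x → g • W = W := by
    intro g hg
    rw [hW, smul_fixedSubgroup, ← hg, mul_inv_cancel_right]
  by_contra! hcon
  obtain ⟨h, hh, hhx⟩ := hcon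
  have hhW : h • W ≠ W := fun e => hhx (hα h hh e)
  have hidxg : ∀ g : MulAut Y, (g • W).index = W.index := fun g =>
    Subgroup.index_map_equiv W g
  have hidx : W.index = r := by
    have hP : IsPGroup r Y := fun y => ⟨1, by simpa using hY y⟩
    obtain ⟨n, hn⟩ := hP.index W
    rcases Nat.eq_zero_or_pos n with rfl | hpos
    · exfalso
      rw [pow_zero, Subgroup.index_eq_one] at hn
      apply hhW
      rw [hn, ← Subgroup.index_eq_one, ← hn, hidxg, hn, Subgroup.index_top]
    · exact le_antisymm hcard (Nat.le_of_dvd (hn ▸ pow_pos hr.pos n)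
        (hn ▸ dvd_pow_self r hpos.ne'))
  have hidx' : ∀ g : MulAut Y, (g • W).index = r := fun g => by
    rw [hidxg, hidx]
  set y := h * x * h⁻¹ with hy
  set C := W ⊓ h • W with hC
  have hCy : ∀ c ∈ C, y c = c := fun c hc => by
    have := hc.2
    rw [SetLike.mem_coe, hW, smul_fixedSubgroup] at this
    exact this
  have hCx : ∀ c ∈ C, x c = c := fun c hc => hc.1
  have hCx' : ∀ c ∈ C, x⁻¹ c = c := fun c hc => by
    apply x.injective; rw [hCx c hc]; simp
  let R₂ : Subgroup (MulAut Y) :=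
    { carrier := {g | g ∈ R ∧ ∀ c ∈ C, g c = c}
      one_mem' := ⟨R.one_mem, fun _ _ => rfl⟩
      mul_mem' := fun {a b} ha hb => ⟨R.mul_mem ha.1 hb.1, fun c hc => by
        rw [MulAut.mul_apply, hb.2 c hc, ha.2 c hc]⟩
      inv_mem' := fun {a} ha => ⟨R.inv_mem ha.1, fun c hc => by
        apply a.injective; rw [ha.2 c hc]; simp⟩ }
  have hR₂norm : ∀ g ∈ R₂, x * g * x⁻¹ ∈ R₂ := fun g hg => ⟨hnorm g hg.1, fun c hc => by
    simp only [MulAut.mul_apply]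
    rw [hCx' c hc, hg.2 c hc, hCx c hc]⟩
  have hR₂p : IsPGroup p R₂ := hR.to_le fun g hg => hg.1
  have hρ : y * x⁻¹ ∈ R₂ := by
    refine ⟨?_, fun c hc => ?_⟩
    · have : y * x⁻¹ = h * (x * h⁻¹ * x⁻¹) := by rw [hy]; group
      rw [this]
      exact R.mul_mem hh (hnorm _ (R.inv_mem hh))
    · rw [MulAut.mul_apply, hCx' c hc, hCy c hc]
  have hρW : (y * x⁻¹) • W ≠ W := by
    intro e
    have hc := hα _ hρ.1 e
    have hyr : y ^ r = 1 := by rw [hy, conj_pow, hx]; group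
    have hcomm : Commute (y * x⁻¹) x := hc.symm
    have e2 := hcomm.mul_pow r
    rw [inv_mul_cancel_right, hyr, hx, mul_one] at e2
    obtain ⟨k, hk⟩ := hpow _ hρ.1
    have e3 := eq_one_of_pow_eq_one_of_coprime (hcop k) e2.symm hk
    rw [mul_inv_eq_one, hy, mul_inv_eq_iff_eq_mul] at e3
    exact hhW (hstab h e3.symm)
  set S : Set (Subgroup Y) := MulAction.orbit R₂ W with hS
  have hCS : ∀ V ∈ S, C ≤ V := by
    rintro _ ⟨⟨g, hg⟩, rfl⟩ c hc
    change c ∈ g • W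
    rw [← hg.2 c hc]
    exact Subgroup.smul_mem_pointwise_smul c g W hc.1
  have hSidx : ∀ V ∈ S, V.index = r := by
    rintro _ ⟨⟨g, hg⟩, rfl⟩
    exact hidx' g
  have hYm : Nat.card Y = r * Nat.card W := by rw [← W.card_mul_index, hidx, mul_comm]
  have hWc : Nat.card W = r * Nat.card C := by
    have := card_inf_mul_card_of_index_prime hr hidx (hidx' h) hhW.symm
    rw [hYm] at this
    exact Nat.eq_of_mul_eq_mul_left hr.pos this
  have hpair : ∀ V ∈ S, ∀ V' ∈ S, V ≠ V' → V ⊓ V' ≤ C := by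
    intro V hV V' hV' hne
    have := card_inf_mul_card_of_index_prime hr (hSidx V hV) (hSidx V' hV') hne
    rw [hYm, hWc] at this
    have hc := Nat.eq_of_mul_eq_mul_left hr.pos (Nat.eq_of_mul_eq_mul_left hr.pos this)
    exact (Subgroup.eq_of_le_of_card_ge (le_inf (hCS V hV) (hCS V' hV')) hc.ge).ge
  have hle := card_le_of_pairwise_inf_eq hr.one_lt S C hYm hWc rfl (fun V hV => by
    have e1 := V.card_mul_index
    rw [hSidx V hV, hYm, mul_comm] at e1
    exact Nat.eq_of_mul_eq_mul_left hr.pos e1) hCS hpair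
  obtain ⟨i, hi⟩ := hR₂p.card_orbit W
  rw [← hS] at hi
  -- the action of `x` on `S`
  have hxS : ∀ V ∈ S, x • V ∈ S := by
    rintro _ ⟨⟨g, hg⟩, rfl⟩
    refine ⟨⟨_, hR₂norm g hg⟩, ?_⟩
    change (x * g * x⁻¹) • W = x • g • W
    rw [mul_smul, mul_smul]
    congr 2
    rw [inv_smul_eq_iff, hstab x rfl]
  have hxfix : ∀ V ∈ S, x • V = V → V = W := by
    rintro _ ⟨⟨g, hg⟩, rfl⟩ hV
    change x • g • W = g • W at hV
    change g • W = W
    by_contra hne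
    have hin : g • W ⊓ W ≤ C := hpair _ ⟨⟨g, hg⟩, rfl⟩ _ (MulAction.mem_orbit_self W) hne
    -- `x` acts trivially modulo `C`
    have hcoat : g • W ⊔ W = ⊤ := by
      have h1 : (g • W ⊔ W).index ∣ r := by
        rw [← hidx]; exact Subgroup.index_dvd_of_le le_sup_right
      rcases (Nat.dvd_prime hr).mp h1 with h1 | h1
      · exact Subgroup.index_eq_one.mp h1
      · exfalso
        have e1 : W = g • W ⊔ W := Subgroup.eq_of_le_of_card_ge le_sup_right (by
          have e1 := W.card_mul_index
          have e2 := (g • W ⊔ W).card_mul_index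
          rw [hidx] at e1
          rw [h1] at e2
          exact (Nat.eq_of_mul_eq_mul_right hr.pos (e2.trans e1.symm)).le)
        have e2 : g • W ≤ W := le_sup_left.trans e1.ge
        exact hne (Subgroup.eq_of_le_of_card_ge e2 (by
          have e1 := W.card_mul_index
          have e2 := (g • W).card_mul_index
          rw [hidx] at e1
          rw [hidx'] at e2
          exact (Nat.eq_of_mul_eq_mul_right hr.pos (e1.trans e2.symm)).le))
    have hxC : ∀ z, x z * z⁻¹ ∈ C := by
      intro z
      obtain ⟨a, ha, b, hb, rfl⟩ := Subgroup.mem_sup.mp (hcoat ▸ Subgroup.mem_top z)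
      have : x (a * b) * (a * b)⁻¹ = x a * a⁻¹ := by
        rw [map_mul, mem_fixedSubgroup.mp hb]; group
      rw [this]
      refine hin ⟨?_, hT a⟩
      refine (g • W).mul_mem ?_ ((g • W).inv_mem ha)
      rw [← hV]
      exact Subgroup.smul_mem_pointwise_smul a x _ ha
    have hgC : ∀ c ∈ C, g c = c := hg.2
    have hgC' : ∀ c ∈ C, g⁻¹ c = c := (R₂.inv_mem hg).2
    have hgR : x * (g * x⁻¹ * g⁻¹) ∈ R := by
      have : x * (g * x⁻¹ * g⁻¹) = (x * g * x⁻¹) * g⁻¹ := by group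
      rw [this]
      exact R.mul_mem (hnorm g hg.1) (R.inv_mem hg.1)
    have h1 := hser _ hgR C (by
      intro c hc
      simp only [MulAut.mul_apply]
      rw [hgC' c hc, hCx' c hc, hgC c hc, hCx c hc]) (by
      intro z
      obtain ⟨w, rfl⟩ : ∃ w, z = g (x w) := ⟨x⁻¹ (g⁻¹ z), by simp⟩
      simp only [MulAut.mul_apply, MulAut.inv_apply_self]
      have e : x (g w) * (g (x w))⁻¹ = (x (g w) * (g w)⁻¹) * (g (x w * w⁻¹))⁻¹ := by
        simp only [map_mul, map_inv]
        group
      rw [e, hgC _ (hxC w)]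
      exact C.mul_mem (hxC _) (C.inv_mem (hxC _)))
    apply hne
    apply hstab
    have e : x * (g * x⁻¹ * g⁻¹) = (x * g) * (g * x)⁻¹ := by group
    rw [e, mul_inv_eq_one] at h1
    exact h1
  have := Fintype.ofFinite S
  classical
  let f : Function.End S := fun V => ⟨x • (V : Subgroup Y), hxS V V.2⟩
  have hfpow : ∀ (n : ℕ) (V : S), (((f ^ n) V : S) : Subgroup Y) = x ^ n • (V : Subgroup Y) := by
    intro n
    induction n with
    | zero => intro V; rw [pow_zero, pow_zero, one_smul]; rfl
    | succ n ih =>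
      intro V
      rw [pow_succ', pow_succ', mul_smul, ← ih]
      rfl
  have hfr : f ^ r ^ 1 = 1 := by
    rw [pow_one]
    funext V
    apply Subtype.ext
    rw [hfpow, hx, one_smul]
    rfl
  have hmod := Equiv.Perm.card_fixedPoints_modEq hfr
  have hone : Fintype.card (Function.fixedPoints f) = 1 := by
    rw [Fintype.card_eq_one_iff]
    refine ⟨⟨⟨W, MulAction.mem_orbit_self W⟩, Subtype.ext (hstab x rfl)⟩, ?_⟩
    rintro ⟨⟨V, hV⟩, hfix⟩
    exact Subtype.ext (Subtype.ext (hxfix V hV (congrArg Subtype.val hfix)))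
  rw [hone, ← Nat.card_eq_fintype_card, hi] at hmod
  rw [hi] at hle
  have hi0 : i ≠ 0 := by
    rintro rfl
    rw [pow_zero, Nat.card_eq_one_iff_unique] at hi
    have := hi.1.elim ⟨_, ⟨⟨_, hρ⟩, rfl⟩⟩ ⟨W, MulAction.mem_orbit_self W⟩
    exact hρW (congrArg Subtype.val this)
  have hge : p ≤ p ^ i := Nat.le_self_pow hi0 p
  have hd : r ∣ p ^ i - 1 := (Nat.modEq_iff_dvd' (by omega)).mp hmod.symm
  have heq : p ^ i = r + 1 := by
    have := Nat.le_of_dvd (by omega) hd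
    omega
  have hodd : Odd (p ^ i) := (hp.odd_of_ne_two (by omega)).pow
  rw [heq] at hodd
  have hr2 : r = 2 := (hr.eq_two_or_odd').resolve_right fun h => by
    rcases h with ⟨k, hk⟩; rcases hodd with ⟨l, hl⟩; omega
  omega

/-- The elements fixed by all automorphisms induced by a subgroup `B` of the acting group. -/
def commonFixed {A R : Type*} [Group A] [Group R] (φ : A →* MulAut R) (B : Subgroup A) :
    Subgroup R where
  carrier := {v | ∀ b ∈ B, φ b v = v}
  one_mem' := fun _ _ => map_one _
  mul_mem' := fun ha hb c hc => by rw [map_mul, ha c hc, hb c hc]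
  inv_mem' := fun ha c hc => by rw [map_inv, ha c hc]

theorem mem_commonFixed {A R : Type*} [Group A] [Group R] {φ : A →* MulAut R} {B : Subgroup A}
    {v : R} : v ∈ commonFixed φ B ↔ ∀ b ∈ B, φ b v = v := Iff.rfl

theorem commonFixed_sup {A R : Type*} [Group A] [Group R] (φ : A →* MulAut R) (B B' : Subgroup A) :
    commonFixed φ (B ⊔ B') = commonFixed φ B ⊓ commonFixed φ B' := by
  ext v
  let S : Subgroup A :=
    { carrier := {b | φ b v = v}
      one_mem' := by simp
      mul_mem' := fun {a b} (ha : φ a v = v) (hb : φ b v = v) => by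
        change φ (a * b) v = v
        rw [map_mul, MulAut.mul_apply, hb, ha]
      inv_mem' := fun {a} (ha : φ a v = v) => by
        change φ a⁻¹ v = v
        apply (φ a).injective
        rw [ha, map_inv, MulAut.apply_inv_self] }
  exact sup_le_iff (a := B) (b := B') (c := S)

theorem norm_mem_commonFixed {A R : Type*} [CommGroup A] [CommGroup R] (φ : A →* MulAut R) {r : ℕ}
    (hA : ∀ a : A, a ^ r = 1) {B : Subgroup A} {v : R} (hv : v ∈ commonFixed φ B) (c : A) :
    ∏ j ∈ Finset.range r, φ (c ^ j) v ∈ commonFixed φ (B ⊔ Subgroup.zpowers c) := by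
  rw [commonFixed_sup]
  constructor
  · refine Subgroup.prod_mem _ fun j _ b hb => ?_
    rw [← MulAut.mul_apply, ← map_mul, mul_comm, map_mul, MulAut.mul_apply, hv b hb]
  · have h1 : φ c (∏ j ∈ Finset.range r, φ (c ^ j) v) = ∏ j ∈ Finset.range r, φ (c ^ j) v := by
      have e : ∀ j, φ c (φ (c ^ j) v) = φ (c ^ (j + 1)) v := fun j => by
        rw [← MulAut.mul_apply, ← map_mul, pow_succ']
      rw [map_prod, Finset.prod_congr rfl fun j _ => e j]
      have h2 := Finset.prod_range_succ (fun j => φ (c ^ j) v) r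
      have h3 := Finset.prod_range_succ' (fun j => φ (c ^ j) v) r
      rw [h2] at h3
      simp only [hA c, pow_zero] at h3
      exact (mul_right_cancel h3).symm
    rintro _ ⟨n, rfl⟩
    have h2 : φ c ∈ MulAction.stabilizer (MulAut R) (∏ j ∈ Finset.range r, φ (c ^ j) v) := h1
    have h3 := Subgroup.zpow_mem _ h2 n
    rw [← map_zpow] at h3
    exact h3

theorem mem_of_pow_mem_of_coprime {A : Type*} [Group A] {B : Subgroup A} {m n : ℕ}
    (h : m.Coprime n) {x : A} (hm : x ^ m ∈ B) (hn : x ^ n ∈ B) : x ∈ B := by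
  have hb := Nat.gcd_eq_gcd_ab m n
  rw [h] at hb
  have : x = (x ^ m) ^ (Nat.gcdA m n) * (x ^ n) ^ (Nat.gcdB m n) := by
    rw [← zpow_natCast, ← zpow_natCast, ← zpow_mul, ← zpow_mul, ← zpow_add, ← hb]
    simp
  rw [this]
  exact B.mul_mem (B.zpow_mem hm _) (B.zpow_mem hn _)

theorem exists_index_prime_fixed_of_comm {A R : Type*} [CommGroup A] [Finite A] [CommGroup R]
    {p r : ℕ} (hp : p.Prime) (hr : r.Prime) (hpr : r ≠ p) (hA : ∀ a : A, a ^ r = 1)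
    (hR : IsPGroup p R) (φ : A →* MulAut R) (hne : ∃ a v, φ a v ≠ v) :
    ∃ B : Subgroup A, B.index = r ∧ ∃ v, (∀ b ∈ B, φ b v = v) ∧ ∃ a, φ a v ≠ v := by
  have := Fact.mk hr
  obtain ⟨B, ⟨v, hv, hvA⟩, hmax⟩ := Set.exists_max_image
    {B : Subgroup A | ∃ v, v ∈ commonFixed φ B ∧ v ∉ commonFixed φ ⊤} (fun B => Nat.card B)
    (Set.toFinite _) (by
      obtain ⟨a, v, hav⟩ := hne
      refine ⟨⊥, v, fun b hb => ?_, fun h => hav (h a (Subgroup.mem_top a))⟩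
      rw [Subgroup.mem_bot] at hb
      simp [hb])
  have hcop : r.Coprime p := (Nat.coprime_primes hr hp).mpr hpr
  have hmax' : ∀ c, c ∉ B → ∏ j ∈ Finset.range r, φ (c ^ j) v ∈ commonFixed φ ⊤ := by
    intro c hc
    by_contra hcon
    have h1 := hmax _ ⟨_, norm_mem_commonFixed φ hA hv c, hcon⟩
    have h2 := Subgroup.eq_of_le_of_card_ge (le_sup_left : B ≤ B ⊔ Subgroup.zpowers c) h1
    apply hc
    rw [h2]
    exact (le_sup_right : Subgroup.zpowers c ≤ _) (Subgroup.mem_zpowers c)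
  have hvA' := hvA
  rw [mem_commonFixed] at hvA
  push Not at hvA
  obtain ⟨x, -, hx⟩ := hvA
  have hxB : x ∉ B := fun h => hx (hv x h)
  refine ⟨B, ?_, v, hv, x, hx⟩
  by_cases htop : B ⊔ Subgroup.zpowers x = ⊤
  · have h1 : B.index ∣ r := by
      have h2 : B.relIndex (Subgroup.zpowers x) = B.index := by
        rw [← Subgroup.relIndex_sup_left, htop, Subgroup.relIndex_top_right]
      rw [← h2, ← orderOf_eq_prime (hA x) (fun h => hxB (h ▸ B.one_mem)), ← Nat.card_zpowers]
      exact Subgroup.relIndex_dvd_card _ _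
    rcases (Nat.dvd_prime hr).mp h1 with h | h
    · exact absurd (Subgroup.index_eq_one.mp h ▸ Subgroup.mem_top x) hxB
    · exact h
  exfalso
  obtain ⟨y, hy⟩ : ∃ y, y ∉ B ⊔ Subgroup.zpowers x := by
    by_contra! h
    exact htop ((Subgroup.eq_top_iff' _).mpr h)
  have hxj : ∀ j, j ∈ Finset.range r → j ≠ 0 → x ^ j ∉ B := by
    intro j hj hj0 hmem
    rw [Finset.mem_range] at hj
    refine hxB (mem_of_pow_mem_of_coprime
      (Nat.coprime_of_lt_prime hj0 hj hr) ?_ hmem)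
    rw [hA]; exact B.one_mem
  have h1 : ∏ i ∈ Finset.range r, ∏ j ∈ Finset.range r, φ ((y * x ^ i) ^ j) v
      ∈ commonFixed φ ⊤ := by
    refine Subgroup.prod_mem _ fun i _ => hmax' _ fun hmem => hy ?_
    have : y = (y * x ^ i) * (x ^ i)⁻¹ := by group
    rw [this]
    exact Subgroup.mul_mem_sup hmem (Subgroup.inv_mem _ (Subgroup.pow_mem _
      (Subgroup.mem_zpowers x) i))
  have e : ∀ j, ∏ i ∈ Finset.range r, φ ((y * x ^ i) ^ j) v
      = φ (y ^ j) (∏ i ∈ Finset.range r, φ ((x ^ j) ^ i) v) := by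
    intro j
    rw [map_prod]
    refine Finset.prod_congr rfl fun i _ => ?_
    rw [← MulAut.mul_apply, ← map_mul, mul_pow, ← pow_mul, ← pow_mul, mul_comm i j]
  rw [Finset.prod_comm, Finset.prod_congr rfl (fun j _ => e j)] at h1
  rw [← Finset.mul_prod_erase _ _ (Finset.mem_range.mpr hr.pos),
    Subgroup.mul_mem_cancel_right] at h1
  · simp only [pow_zero, one_pow, map_one, MulAut.one_apply, Finset.prod_const,
      Finset.card_range] at h1
    obtain ⟨k, hk⟩ := hR v
    exact hvA' (mem_of_pow_mem_of_coprime (hcop.pow_right k) h1 (hk ▸ one_mem _))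
  · refine Subgroup.prod_mem _ fun j hj => ?_
    rw [Finset.mem_erase] at hj
    have h2 := hmax' _ (hxj j hj.2 hj.1)
    rw [h2 (y ^ j) (Subgroup.mem_top _)]
    exact h2

/-- The automorphism of a quotient induced by an automorphism preserving a characteristic
subgroup. -/
def quotientMulAut {R : Type*} [Group R] (Z : Subgroup R) [Z.Characteristic] :
    MulAut R →* MulAut (R ⧸ Z) where
  toFun u := QuotientGroup.congr Z Z u (Subgroup.characteristic_iff_map_eq.mp inferInstance u)
  map_one' := by
    ext x
    induction x using QuotientGroup.induction_on
    rfl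
  map_mul' u v := by
    ext x
    induction x using QuotientGroup.induction_on
    rfl

theorem apply_eq_self_of_apply_div_mem {R : Type*} [Group R] {p r : ℕ} (hcop : r.Coprime p)
    (hR : IsPGroup p R) {u : MulAut R} (hu : u ^ r = 1) {v : R} (hz : u (u v * v⁻¹) = u v * v⁻¹) :
    u v = v := by
  have h : ∀ n : ℕ, (u ^ n) v = (u v * v⁻¹) ^ n * v := by
    intro n
    induction n with
    | zero => simp
    | succ n ih =>
      rw [pow_succ', MulAut.mul_apply, ih, map_mul, map_pow, hz, pow_succ]
      group
  have h1 := h r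
  rw [hu, MulAut.one_apply, eq_comm, mul_eq_right] at h1
  obtain ⟨k, hk⟩ := hR (u v * v⁻¹)
  have := eq_one_of_pow_eq_one_of_coprime (hcop.pow_right k) h1 hk
  rwa [mul_inv_eq_one] at this

/-- If an elementary abelian `r`-group `A` acts nontrivially on a `p`-group, then some subgroup of
index `r` in `A` fixes an element that `A` does not fix. -/
theorem exists_index_prime_fixed {A : Type*} [CommGroup A] [Finite A]
    {p r : ℕ} (hp : p.Prime) (hr : r.Prime) (hpr : r ≠ p) (hA : ∀ a : A, a ^ r = 1) :
    ∀ (n : ℕ) {R : Type*} [Group R] [Finite R] (_ : Nat.card R = n)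
    (_ : IsPGroup p R) (φ : A →* MulAut R) (_ : ∃ a v, φ a v ≠ v),
    ∃ B : Subgroup A, B.index = r ∧ ∃ v, (∀ b ∈ B, φ b v = v) ∧ ∃ a, φ a v ≠ v := by
  intro n
  induction n using Nat.strong_induction_on with
  | _ n ih =>
  intro R _ _ hn hR φ hne
  have := Fact.mk hp
  have hcop : r.Coprime p := (Nat.coprime_primes hr hp).mpr hpr
  have hpow : ∀ a, φ a ^ r = 1 := fun a => by rw [← map_pow, hA, map_one]
  by_cases hZ : ∃ a, ∃ v ∈ Subgroup.center R, φ a v ≠ v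
  · obtain ⟨a, v, hv, hav⟩ := hZ
    let _ : CommGroup (Subgroup.center R) :=
      { (inferInstance : Group (Subgroup.center R)) with mul_comm := mul_comm' }
    obtain ⟨B, hB, w, hw, c, hc⟩ := exists_index_prime_fixed_of_comm hp hr hpr hA
      (hR.to_subgroup (Subgroup.center R)) ((MulAut.characteristic (Subgroup.center R)).comp φ)
      ⟨a, ⟨v, hv⟩, fun h => hav (congrArg Subtype.val h)⟩
    exact ⟨B, hB, w, fun b hb => congrArg Subtype.val (hw b hb), c,
      fun h => hc (Subtype.ext h)⟩
  · push Not at hZ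
    have hnt : Nontrivial R := by
      obtain ⟨a, v, hav⟩ := hne
      exact ⟨⟨_, _, hav⟩⟩
    have hZnt := hR.center_nontrivial
    have hlt : Nat.card (R ⧸ Subgroup.center R) < n := by
      rw [← hn, Subgroup.card_eq_card_quotient_mul_card_subgroup (Subgroup.center R)]
      have h1 : 1 < Nat.card (Subgroup.center R) := Finite.one_lt_card
      have h2 : 0 < Nat.card (R ⧸ Subgroup.center R) := Nat.card_pos
      nlinarith
    have hlift : ∀ a (v : R), (φ a v : R ⧸ Subgroup.center R) = v → φ a v = v := by
      intro a v h
      refine apply_eq_self_of_apply_div_mem hcop hR (hpow a) (hZ a _ ?_)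
      rw [← QuotientGroup.eq_one_iff, QuotientGroup.mk_mul, QuotientGroup.mk_inv, h,
        mul_inv_cancel]
    obtain ⟨B, hB, v, hv, c, hc⟩ := ih _ hlt (R := R ⧸ Subgroup.center R) rfl
      (hR.to_quotient _) ((quotientMulAut _).comp φ) (by
        obtain ⟨a, v, hav⟩ := hne
        exact ⟨a, v, fun h => hav (hlift a v h)⟩)
    induction v using QuotientGroup.induction_on with
    | H v =>
    exact ⟨B, hB, v, fun b hb => hlift b v (hv b hb), c, fun h => hc (congrArg _ h)⟩

/-- Restriction of an action by automorphisms to an invariant subgroup. -/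
def restrictMulAut {S Y : Type*} [Group S] [Group Y] (ρ : S →* MulAut Y) (W : Subgroup Y)
    (hW : ∀ s, ∀ w ∈ W, ρ s w ∈ W) : S →* MulAut W where
  toFun s :=
    { toFun := fun w => ⟨ρ s w, hW s w w.2⟩
      invFun := fun w => ⟨ρ s⁻¹ w, hW s⁻¹ w w.2⟩
      left_inv := fun w => Subtype.ext (by simp)
      right_inv := fun w => Subtype.ext (by simp)
      map_mul' := fun w w' => Subtype.ext (by simp) }
  map_one' := by ext; simp
  map_mul' s t := by ext; simp

theorem commute_of_card_commonFixed_le {A Y : Type*} [CommGroup A] [Finite A] [CommGroup Y]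
    [Finite Y] {p r : ℕ} (hp : p.Prime) (hp5 : 5 ≤ p) (hr : r.Prime) (hpr : r ≠ p)
    (hA : ∀ a : A, a ^ r = 1) (hY : ∀ y : Y, y ^ r = 1) (ρ : A →* MulAut Y)
    {R : Subgroup (MulAut Y)} (hR : IsPGroup p R) (hnorm : ∀ a, ∀ g ∈ R, ρ a * g * (ρ a)⁻¹ ∈ R)
    (hmax : ∀ B : Subgroup A, B.index = r →
      Nat.card (commonFixed ρ B) ≤ r * Nat.card (commonFixed ρ ⊤)) :
    ∀ a, ∀ g ∈ R, ρ a * g = g * ρ a := by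
  have := Fact.mk hr
  by_contra! hcon
  let φ : A →* MulAut R := restrictMulAut (MulAut.conj.comp ρ) R hnorm
  obtain ⟨B, hB, ⟨v, hvR⟩, hv, x, hx⟩ := exists_index_prime_fixed hp hr hpr hA _ rfl hR φ (by
    obtain ⟨a, g, hg, hne⟩ := hcon
    refine ⟨a, ⟨g, hg⟩, fun h => hne ?_⟩
    have h1 : ρ a * g * (ρ a)⁻¹ = g := congrArg Subtype.val h
    rwa [mul_inv_eq_iff_eq_mul] at h1)
  have hv' : ∀ b ∈ B, ρ b * v = v * ρ b := fun b hb => by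
    have h1 : ρ b * v * (ρ b)⁻¹ = v := congrArg Subtype.val (hv b hb)
    rwa [mul_inv_eq_iff_eq_mul] at h1
  have hx' : ρ x * v ≠ v * ρ x := fun h => hx (Subtype.ext (by
    change ρ x * v * (ρ x)⁻¹ = v
    rwa [mul_inv_eq_iff_eq_mul]))
  have hxB : x ∉ B := fun h => hx' (hv' x h)
  have htop : B ⊔ Subgroup.zpowers x = ⊤ := by
    have h1 : (B ⊔ Subgroup.zpowers x).index ∣ r := by
      rw [← hB]; exact Subgroup.index_dvd_of_le le_sup_left
    rcases (Nat.dvd_prime hr).mp h1 with h1 | h1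
    · exact Subgroup.index_eq_one.mp h1
    · exfalso
      have h2 : B = B ⊔ Subgroup.zpowers x := Subgroup.eq_of_le_of_card_ge le_sup_left (by
        have e1 := B.card_mul_index
        have e2 := (B ⊔ Subgroup.zpowers x).card_mul_index
        rw [hB] at e1
        rw [h1] at e2
        exact (Nat.eq_of_mul_eq_mul_right hr.pos (e2.trans e1.symm)).le)
      exact hxB (h2 ▸ (le_sup_right : Subgroup.zpowers x ≤ B ⊔ _) (Subgroup.mem_zpowers x))
  let W := commonFixed ρ B
  let S : Subgroup (MulAut Y) := Subgroup.centralizer (B.map ρ)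
  have hS : ∀ {s}, s ∈ S ↔ ∀ b ∈ B, ρ b * s = s * ρ b := fun {s} => by
    simp [S, Subgroup.mem_centralizer_iff]
  have hSW : ∀ s : S, ∀ w ∈ W, S.subtype s w ∈ W := by
    rintro ⟨s, hs⟩ w hw b hb
    have := DFunLike.congr_fun (hS.mp hs b hb) w
    simp only [MulAut.mul_apply] at this
    rw [hw b hb] at this
    exact this
  let θ := restrictMulAut S.subtype W hSW
  have hxS : ρ x ∈ S := hS.mpr fun b _ => by rw [← map_mul, mul_comm, map_mul]
  have hvS : v ∈ S := hS.mpr hv'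
  have hT := commute_of_index_fixedSubgroup_le (Y := W) hp hp5 hr hpr
    (fun y => Subtype.ext (by simpa using hY y)) (x := θ ⟨ρ x, hxS⟩) (by
      rw [← map_pow]
      have : (⟨ρ x, hxS⟩ : S) ^ r = 1 := Subtype.ext (by
        simp only [SubgroupClass.coe_pow, OneMemClass.coe_one]
        rw [← map_pow, hA, map_one])
      rw [this, map_one]) (R := (R.subgroupOf S).map θ)
    (by
      refine IsPGroup.map ?_ θ
      rintro ⟨s, hs⟩
      obtain ⟨k, hk⟩ := hR ⟨s, hs⟩
      exact ⟨k, Subtype.ext (Subtype.ext (by simpa using congrArg Subtype.val hk))⟩)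
    (by
      rintro _ ⟨g, hg, rfl⟩
      refine ⟨⟨ρ x, hxS⟩ * g * ⟨ρ x, hxS⟩⁻¹, ?_, by simp⟩
      exact hnorm x g hg)
    (by
      have h1 : Nat.card (fixedSubgroup (θ ⟨ρ x, hxS⟩)) = Nat.card (commonFixed ρ ⊤) := by
        refine Nat.card_congr
          { toFun := fun w => ⟨w.1.1, ?_⟩
            invFun := fun y => ⟨⟨y.1, fun b _ => y.2 b (Subgroup.mem_top b)⟩, ?_⟩
            left_inv := fun _ => rfl
            right_inv := fun _ => rfl }
        · rw [← htop, commonFixed_sup]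
          refine ⟨w.1.2, ?_⟩
          have h2 : ρ x w.1.1 = w.1.1 := congrArg Subtype.val (w.2)
          rintro _ ⟨n, rfl⟩
          have h3 : ρ x ∈ MulAction.stabilizer (MulAut Y) w.1.1 := h2
          have h4 := Subgroup.zpow_mem _ h3 n
          rw [← map_zpow] at h4
          exact h4
        · exact Subtype.ext (y.2 x (Subgroup.mem_top x))
      have h2 := (fixedSubgroup (θ ⟨ρ x, hxS⟩)).card_mul_index
      have h3 := hmax B hB
      have h4 : 0 < Nat.card (fixedSubgroup (θ ⟨ρ x, hxS⟩)) := Nat.card_pos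
      rw [← h1, mul_comm] at h3
      exact Nat.le_of_mul_le_mul_left (h2.le.trans h3) h4)
    (θ ⟨v, hvS⟩) ⟨⟨v, hvS⟩, hvR, rfl⟩
  have huR : ρ x * v * (ρ x)⁻¹ * v⁻¹ ∈ R := R.mul_mem (hnorm x v hvR) (R.inv_mem hvR)
  obtain ⟨k, hk⟩ := hR ⟨_, huR⟩
  have hk' : (ρ x * v * (ρ x)⁻¹ * v⁻¹) ^ p ^ k = 1 := by simpa using congrArg Subtype.val hk
  have hu := mulAut_eq_one_of_trivial_on_fixed hr
    (Nat.Coprime.pow_right k ((Nat.coprime_primes hr hp).mpr hpr)) hY hk' (B := B.map ρ)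
    (by
      rintro ⟨_, b, hb, rfl⟩
      refine ⟨1, Subtype.ext ?_⟩
      simp only [pow_one, SubgroupClass.coe_pow, OneMemClass.coe_one]
      rw [← map_pow, hA, map_one])
    (by
      have huS : ρ x * v * (ρ x)⁻¹ * v⁻¹ ∈ S :=
        S.mul_mem (S.mul_mem (S.mul_mem hxS hvS) (S.inv_mem hxS)) (S.inv_mem hvS)
      rintro _ ⟨b, hb, rfl⟩
      exact (hS.mp huS b hb).symm)
    (by
      intro y hy
      have hyW : y ∈ W := fun b hb => hy _ ⟨b, hb, rfl⟩
      have hyW' : (ρ x)⁻¹ (v⁻¹ y) ∈ W := hSW ⟨_, S.inv_mem hxS⟩ _ (hSW ⟨_, S.inv_mem hvS⟩ _ hyW)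
      have h1 := congrArg Subtype.val (DFunLike.congr_fun hT ⟨_, hyW'⟩)
      change ρ x (v ((ρ x)⁻¹ (v⁻¹ y))) = v (ρ x ((ρ x)⁻¹ (v⁻¹ y))) at h1
      simp only [MulAut.mul_apply]
      rw [h1]
      simp)
  apply hx'
  rwa [mul_inv_eq_one, mul_inv_eq_iff_eq_mul] at hu

theorem exists_invariant_sylow {A N : Type*} [Group A] [Group N] [Finite N] {p r : ℕ}
    (hp : p.Prime) (hr : r.Prime) (hA : IsPGroup r A) (φ : A →* MulAut N)
    (hN : ¬ r ∣ Nat.card N) : ∃ P : Sylow p N, ∀ a, ∀ g ∈ P, φ a g ∈ P := by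
  have := Fact.mk hp
  have := Fact.mk hr
  let _ : MulAction A (Sylow p N) := MulAction.compHom _ φ
  have hcard : ¬ r ∣ Nat.card (Sylow p N) := fun h =>
    hN (h.trans ((Sylow.card_dvd_index default).trans (Subgroup.index_dvd_card _)))
  obtain ⟨P, hP⟩ := hA.nonempty_fixed_point_of_prime_not_dvd_card (Sylow p N) hcard
  refine ⟨P, fun a g hg => ?_⟩
  have h1 : φ a • P = P := hP a
  have h2 := Subgroup.smul_mem_pointwise_smul g (φ a) (P : Subgroup N) hg
  have h3 : φ a g ∈ φ a • P := h2
  rwa [h1] at h3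

theorem eq_top_of_forall_sylow_le {D : Type*} [Group D] [Finite D] {L : Subgroup D}
    (h : ∀ s : ℕ, s.Prime → ∃ P : Sylow s D, (P : Subgroup D) ≤ L) : L = ⊤ := by
  rw [← Subgroup.index_eq_one]
  by_contra hne
  obtain ⟨s, hs, hd⟩ := Nat.exists_prime_and_dvd hne
  obtain ⟨P, hP⟩ := h s hs
  have := Fact.mk hs
  exact P.not_dvd_index (hd.trans (Subgroup.index_dvd_of_le hP))

/-- In a solvable group, an `r`-element commuting with all normal subgroups of prime power order
lies in a normal `r`-subgroup. -/
theorem exists_normal_pGroup_of_commute {Γ : Type*} [Group Γ] [Finite Γ] [Group.IsSolvable Γ]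
    {r : ℕ}
    {x : Γ} (hx : ∃ k, x ^ r ^ k = 1)
    (hcomm : ∀ s : ℕ, s.Prime → ∀ N : Subgroup Γ, N.Normal → IsPGroup s N →
      ∀ n ∈ N, x * n = n * x) :
    ∃ D : Subgroup Γ, D.Normal ∧ IsPGroup r D ∧ x ∈ D := by
  let S : Set Γ := {n | ∃ s : ℕ, s.Prime ∧ ∃ N : Subgroup Γ, N.Normal ∧ IsPGroup s N ∧ n ∈ N}
  have hmem : ∀ {c}, c ∈ Subgroup.centralizer S ↔ ∀ n ∈ S, n * c = c * n :=
    Subgroup.mem_centralizer_iff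
  set C := Subgroup.centralizer S with hC
  have hCn : C.Normal := ⟨fun c hc g => hmem.mpr (by
    rintro n ⟨s, hs, N, hN, hNs, hn⟩
    have h1 := hmem.mp hc (g⁻¹ * n * g) ⟨s, hs, N, hN, hNs, by simpa using hN.conj_mem n hn g⁻¹⟩
    have h2 : g * (g⁻¹ * n * g * c) * g⁻¹ = g * (c * (g⁻¹ * n * g)) * g⁻¹ := by rw [h1]
    convert h2 using 1 <;> group)⟩
  have hkey : ∀ k, derivedSeries C (k + 1) ≤ Subgroup.center C →
      derivedSeries C k ≤ Subgroup.center C := by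
    intro k hk
    set D := derivedSeries C k with hD
    have hnil : Group.IsNilpotent D := by
      rw [Subgroup.nilpotent_iff_lowerCentralSeries]
      refine ⟨2, ?_⟩
      rw [Subgroup.lowerCentralSeries_succ, Subgroup.top_lowerCentralSeries_one,
        Subgroup.commutator_eq_bot_iff_le_centralizer]
      intro z hz
      rw [Subgroup.mem_centralizer_iff]
      intro w _
      have h1 : (z : C) ∈ derivedSeries C (k + 1) := by
        rw [derivedSeries_succ, ← hD]
        have : (commutator D).map D.subtype = ⁅D, D⁆ := by
          rw [commutator_def, Subgroup.map_commutator, ← MonoidHom.range_eq_map,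
            Subgroup.range_subtype]
        rw [← this]
        exact ⟨z, hz, rfl⟩
      exact Subtype.ext (Subgroup.mem_center_iff.mp (hk h1) w)
    have hSyl : ∀ (s : ℕ) (_ : Fact s.Prime) (P : Sylow s D), (P : Subgroup D).Normal :=
      ((Group.isNilpotent_of_finite_tfae (G := D)).out 0 3).mp hnil
    have htop : (Subgroup.center C).subgroupOf D = ⊤ := by
      refine eq_top_of_forall_sylow_le fun s hs => ?_
      have hs' := Fact.mk hs
      refine ⟨default, ?_⟩
      set P : Sylow s D := default
      have hPc := P.characteristic_of_normal (hSyl s hs' P)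
      have hPn : ((P : Subgroup D).map D.subtype).Characteristic := inferInstance
      have hPn' : (((P : Subgroup D).map D.subtype).map C.subtype).Normal := inferInstance
      intro g hg
      rw [Subgroup.mem_subgroupOf, Subgroup.mem_center_iff]
      intro c
      refine Subtype.ext (hmem.mp c.2 g ⟨s, hs, _, hPn', ?_, ?_⟩).symm
      · exact (P.2.map _).map _
      · exact ⟨g, ⟨g, hg, rfl⟩, rfl⟩
    exact Subgroup.subgroupOf_eq_top.mp htop
  have hCcomm : ∀ a ∈ C, ∀ b ∈ C, a * b = b * a := by
    have hall : ∀ k, derivedSeries C k ≤ Subgroup.center C →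
        derivedSeries C 0 ≤ Subgroup.center C := by
      intro k
      induction k with
      | zero => exact id
      | succ k ih => exact fun h => ih (hkey k h)
    obtain ⟨n, hn⟩ := (Group.isSolvable_def C).mp inferInstance
    have h0 := hall n (hn ▸ bot_le)
    intro a ha b hb
    have h1 := Subgroup.mem_center_iff.mp (h0 (Subgroup.mem_top (⟨b, hb⟩ : C))) ⟨a, ha⟩
    exact congrArg Subtype.val h1
  refine ⟨{ carrier := {c | c ∈ C ∧ ∃ k, c ^ r ^ k = 1}
            one_mem' := ⟨C.one_mem, 0, one_pow _⟩
            mul_mem' := ?_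
            inv_mem' := ?_ }, ⟨?_⟩, ?_, ?_, hx⟩
  · rintro a b ⟨ha, k, hk⟩ ⟨hb, l, hl⟩
    refine ⟨C.mul_mem ha hb, k + l, ?_⟩
    have : Commute a b := hCcomm a ha b hb
    rw [this.mul_pow]
    have e1 : a ^ r ^ (k + l) = 1 := by rw [pow_add, pow_mul, hk, one_pow]
    have e2 : b ^ r ^ (k + l) = 1 := by rw [pow_add, mul_comm, pow_mul, hl, one_pow]
    rw [e1, e2, one_mul]
  · rintro a ⟨ha, k, hk⟩
    exact ⟨C.inv_mem ha, k, by rw [inv_pow, hk, inv_one]⟩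
  · rintro c ⟨hc, k, hk⟩ g
    exact ⟨hCn.conj_mem c hc g, k, by rw [conj_pow, hk]; group⟩
  · rintro ⟨c, hc, k, hk⟩
    exact ⟨k, Subtype.ext hk⟩
  · refine hmem.mpr ?_
    rintro n ⟨s, hs, N, hN, hNs, hn⟩
    exact (hcomm s hs N hN hNs n hn).symm

theorem sup_eq_top_of_not_le {G : Type*} [Group G] {H N : Subgroup G} (hH : IsCoatom H)
    (h : ¬ N ≤ H) : N ⊔ H = ⊤ :=
  hH.2 _ (lt_of_le_of_ne le_sup_right fun e => h (e ▸ le_sup_left))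

theorem exists_mul_of_not_le {G : Type*} [Group G] {H N : Subgroup G} [N.Normal] (hH : IsCoatom H)
    (h : ¬ N ≤ H) (g : G) : ∃ n ∈ N, ∃ x ∈ H, n * x = g := by
  rw [← Subgroup.mem_sup_of_normal_left, sup_eq_top_of_not_le hH h]
  exact Subgroup.mem_top g

theorem relIndex_eq_index_of_not_le {G : Type*} [Group G] [Finite G] {H N : Subgroup G} [N.Normal]
    (hH : IsCoatom H) (hN : ¬ N ≤ H) : H.relIndex N = H.index := by
  have h1 : N.relIndex H = N.index := by
    rw [← Subgroup.relIndex_sup_right, sup_comm, sup_eq_top_of_not_le hH hN,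
      Subgroup.relIndex_top_right]
  have h2 : H.relIndex N * N.index = N.relIndex H * H.index := by
    rw [← Subgroup.inf_relIndex_right H N, Subgroup.relIndex_mul_index inf_le_right,
      ← Subgroup.inf_relIndex_right N H, Subgroup.relIndex_mul_index inf_le_right, inf_comm]
  rw [h1, mul_comm] at h2
  exact Nat.eq_of_mul_eq_mul_left (Nat.pos_of_ne_zero Subgroup.index_ne_zero_of_finite) h2

/-- `M` is the full preimage of the socle of the primitive group `G ⧸ core(H)`. -/
structure IsSocleOver {G : Type*} [Group G] (H M : Subgroup G) : Prop where
  normal : M.Normal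
  core_le : H.normalCore ≤ M
  not_le : ¬ M ≤ H
  comm : ∀ m ∈ M, ∀ m' ∈ M, ⁅m, m'⁆ ∈ H.normalCore
  inf_eq : M ⊓ H = H.normalCore
  mem_of_comm : ∀ g, (∀ m ∈ M, ⁅m, g⁆ ∈ H.normalCore) → g ∈ M

theorem normal_of_conj_mem_of_sup {G : Type*} [Group G] {H M N : Subgroup G} [M.Normal]
    (hH : IsCoatom H) (hM : ¬ M ≤ H) (h1 : ∀ m ∈ M, ∀ n ∈ N, m * n * m⁻¹ ∈ N)
    (h2 : ∀ x ∈ H, ∀ n ∈ N, x * n * x⁻¹ ∈ N) : N.Normal := by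
  refine ⟨fun n hn g => ?_⟩
  obtain ⟨m, hm, x, hx, rfl⟩ := exists_mul_of_not_le hH hM g
  have := h1 m hm _ (h2 x hx n hn)
  convert this using 1
  group

theorem exists_isSocleOver {G : Type*} [Group G] [Group.IsSolvable G] {H : Subgroup G}
    (hH : IsCoatom H) : ∃ M, IsSocleOver H M := by
  classical
  set C := H.normalCore with hC
  have hCH : C ≤ H := H.normalCore_le
  have hex : ∃ n, derivedSeries (G ⧸ C) n = ⊥ := (Group.isSolvable_def _).mp inferInstance
  have hnt : Nontrivial (G ⧸ C) := by
    rw [QuotientGroup.nontrivial_iff]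
    exact fun h => hH.1 (top_le_iff.mp (h ▸ hCH))
  obtain ⟨n, hn, hn1⟩ : ∃ n, derivedSeries (G ⧸ C) (n + 1) = ⊥ ∧
      derivedSeries (G ⧸ C) n ≠ ⊥ := by
    have h0 : Nat.find hex ≠ 0 := fun h => by
      have := Nat.find_spec hex
      rw [h, derivedSeries_zero] at this
      exact bot_ne_top this.symm
    obtain ⟨n, hn⟩ := Nat.exists_eq_succ_of_ne_zero h0
    exact ⟨n, by rw [← Nat.succ_eq_add_one, ← hn]; exact Nat.find_spec hex,
      Nat.find_min hex (hn ▸ Nat.lt_succ_self n)⟩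
  set D := derivedSeries (G ⧸ C) n
  let M := D.comap (QuotientGroup.mk' C)
  have hMmem : ∀ {g}, g ∈ M ↔ (g : G ⧸ C) ∈ D := Iff.rfl
  have hMn : M.Normal := inferInstance
  have hCM : C ≤ M := fun c hc => by
    rw [hMmem, (QuotientGroup.eq_one_iff c).mpr hc]; exact D.one_mem
  have hMH : ¬ M ≤ H := by
    intro h
    apply hn1
    rw [eq_bot_iff]
    intro d hd
    induction d using QuotientGroup.induction_on with
    | H g =>
    exact (QuotientGroup.eq_one_iff g).mpr (Subgroup.normal_le_normalCore.mpr h hd)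
  have hcomm : ∀ m ∈ M, ∀ m' ∈ M, ⁅m, m'⁆ ∈ C := by
    intro m hm m' hm'
    have h1 : ⁅(m : G ⧸ C), (m' : G ⧸ C)⁆ ∈ derivedSeries (G ⧸ C) (n + 1) :=
      Subgroup.commutator_mem_commutator hm hm'
    rw [hn, Subgroup.mem_bot] at h1
    exact (QuotientGroup.eq_one_iff _).mp h1
  have key : ∀ N : Subgroup G, N.Normal → (∀ m ∈ M, ∀ g ∈ N, ⁅m, g⁆ ∈ C) → N ⊓ H ≤ C := by
    intro N hN hNM
    have : (N ⊓ H).Normal := by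
      refine normal_of_conj_mem_of_sup hH hMH (fun m hm x hx => ⟨hN.conj_mem x hx.1 m, ?_⟩)
        (fun y hy x hx => ⟨hN.conj_mem x hx.1 y, H.mul_mem (H.mul_mem hy hx.2) (H.inv_mem hy)⟩)
      have e : m * x * m⁻¹ = ⁅m, x⁆ * x := by rw [commutatorElement_def]; group
      rw [e]
      exact H.mul_mem (hCH (hNM m hm x hx.1)) hx.2
    exact Subgroup.normal_le_normalCore.mpr inf_le_right
  refine ⟨M, hMn, hCM, hMH, hcomm, le_antisymm (key M hMn hcomm) (le_inf hCM hCH), ?_⟩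
  intro g hg
  let Q : Subgroup G := (Subgroup.centralizer (D : Set (G ⧸ C))).comap (QuotientGroup.mk' C)
  have hQ : ∀ {q}, q ∈ Q ↔ ∀ m ∈ M, ⁅m, q⁆ ∈ C := by
    intro q
    change (q : G ⧸ C) ∈ Subgroup.centralizer (D : Set (G ⧸ C)) ↔ _
    rw [Subgroup.mem_centralizer_iff]
    constructor
    · intro h m hm
      refine (QuotientGroup.eq_one_iff _).mp ?_
      exact commutatorElement_eq_one_iff_mul_comm.mpr (h m hm)
    · intro h d hd
      induction d using QuotientGroup.induction_on with
      | H m =>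
      exact commutatorElement_eq_one_iff_mul_comm.mp ((QuotientGroup.eq_one_iff _).mpr (h m hd))
  have hQH := key Q inferInstance fun m hm q hq => hQ.mp hq m hm
  obtain ⟨m, hm, x, hx, rfl⟩ := exists_mul_of_not_le hH hMH g
  have hxQ : x ∈ Q := by
    have e : x = m⁻¹ * (m * x) := by group
    rw [e]
    exact Q.mul_mem (Q.inv_mem (hQ.mpr fun m' hm' => hcomm m' hm' m hm)) (hQ.mpr hg)
  exact M.mul_mem hm (hCM (hQH ⟨hxQ, hx⟩))

namespace IsSocleOver

variable {G : Type*} [Group G] {H M : Subgroup G}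

theorem le_sup_core (hM : IsSocleOver H M) (hH : IsCoatom H) {N : Subgroup G} [N.Normal]
    (hN : ¬ N ≤ H) : M ≤ N ⊔ H.normalCore := by
  have := hM.normal
  have h1 : ¬ N ⊓ M ≤ H := by
    intro h
    have hNC : N ⊓ M ≤ H.normalCore := Subgroup.normal_le_normalCore.mpr h
    apply hN
    intro n hn
    have hnM : n ∈ M := hM.mem_of_comm n fun m hm => hNC
      ⟨by rw [commutatorElement_def]
          exact N.mul_mem (Subgroup.Normal.conj_mem inferInstance n hn m) (N.inv_mem hn),
       by rw [commutatorElement_def]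
          rw [mul_assoc, mul_assoc, ← mul_assoc n]
          exact M.mul_mem hm (this.conj_mem _ (M.inv_mem hm) n)⟩
    exact H.normalCore_le (hNC ⟨hn, hnM⟩)
  intro m hm
  obtain ⟨n, hn, x, hx, rfl⟩ := exists_mul_of_not_le hH h1 m
  refine Subgroup.mul_mem_sup hn.1 ?_
  rw [← hM.inf_eq]
  refine ⟨?_, hx⟩
  have e : x = n⁻¹ * (n * x) := by group
  rw [e]
  exact M.mul_mem (M.inv_mem hn.2) hm

theorem relIndex_eq [Finite G] (hM : IsSocleOver H M) (hH : IsCoatom H) :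
    H.normalCore.relIndex M = H.index := by
  have := hM.normal
  rw [← hM.inf_eq, Subgroup.inf_relIndex_left, relIndex_eq_index_of_not_le hH hM.not_le]

theorem commutator_mem_of_isPGroup [Finite G] (hM : IsSocleOver H M) (hH : IsCoatom H) {p a : ℕ}
    (hp : p.Prime) (hidx : H.index = p ^ a) {B : Subgroup G} (hB : IsPGroup p B)
    (hBH : ∀ x ∈ H, ∀ b ∈ B, x * b * x⁻¹ ∈ B) : ∀ m ∈ M, ∀ b ∈ B, ⁅m, b⁆ ∈ H.normalCore := by
  have := hM.normal
  set C := H.normalCore with hC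
  have ha : a ≠ 0 := by
    rintro rfl
    rw [pow_zero, Subgroup.index_eq_one] at hidx
    exact hH.1 hidx
  let D : Subgroup G := M ⊓ (Subgroup.centralizer
    ((B.map (QuotientGroup.mk' C) : Subgroup (G ⧸ C)) : Set (G ⧸ C))).comap (QuotientGroup.mk' C)
  have hD : ∀ {d}, d ∈ D ↔ d ∈ M ∧ ∀ b ∈ B, ⁅b, d⁆ ∈ C := by
    intro d
    refine and_congr_right fun _ => ?_
    change (d : G ⧸ C) ∈ Subgroup.centralizer _ ↔ _
    rw [Subgroup.mem_centralizer_iff]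
    constructor
    · intro h b hb
      exact (QuotientGroup.eq_one_iff _).mp
        (commutatorElement_eq_one_iff_mul_comm.mpr (h b ⟨b, hb, rfl⟩))
    · rintro h _ ⟨b, hb, rfl⟩
      exact commutatorElement_eq_one_iff_mul_comm.mp ((QuotientGroup.eq_one_iff _).mpr (h b hb))
  have hCn : C.Normal := inferInstance
  have hDn : D.Normal := by
    refine normal_of_conj_mem_of_sup hH hM.not_le (fun m hm d hd => ?_) (fun x hx d hd => ?_)
    · have e : m * d * m⁻¹ = ⁅m, d⁆ * d := by rw [commutatorElement_def]; group
      rw [e]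
      refine D.mul_mem ?_ hd
      have h1 := hM.comm m hm d (hD.mp hd).1
      refine hD.mpr ⟨hM.core_le h1, fun b hb => ?_⟩
      rw [commutatorElement_def]
      exact C.mul_mem (hCn.conj_mem _ h1 b) (C.inv_mem h1)
    · obtain ⟨hd1, hd2⟩ := hD.mp hd
      refine hD.mpr ⟨hM.normal.conj_mem d hd1 x, fun b hb => ?_⟩
      have h1 := hBH x⁻¹ (H.inv_mem hx) b hb
      have h2 := hCn.conj_mem _ (hd2 _ h1) x
      convert h2 using 1
      simp only [commutatorElement_def]
      group
  obtain ⟨t, ⟨m, hm, rfl⟩, hne, hfix⟩ := exists_fixed_ne_one_of_dvd_card hp hB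
    ((MulAut.conj.comp (QuotientGroup.mk' C)).comp B.subtype) (M.map (QuotientGroup.mk' C)) (by
      rintro b _ ⟨m, hm, rfl⟩
      exact ⟨b * m * b⁻¹, hM.normal.conj_mem m hm b, by simp⟩) (by
      rw [← Subgroup.relIndex_ker, QuotientGroup.ker_mk', hC, hM.relIndex_eq hH, hidx]
      exact dvd_pow_self p ha)
  have hmD : m ∈ D := hD.mpr ⟨hm, fun b hb => (QuotientGroup.eq_one_iff _).mp (by
    have := hfix ⟨b, hb⟩
    have h1 : (b : G ⧸ C) * m * (b : G ⧸ C)⁻¹ = m := this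
    change ⁅(b : G ⧸ C), (m : G ⧸ C)⁆ = 1
    rw [commutatorElement_def, h1, mul_inv_cancel])⟩
  have hmC : m ∉ C := fun h => hne ((QuotientGroup.eq_one_iff m).mpr h)
  have hDH : ¬ D ≤ H := fun h => hmC (hM.inf_eq.le ⟨hm, h hmD⟩)
  have hMD := hM.le_sup_core hH hDH
  have hCD : C ≤ D := fun c hc => hD.mpr ⟨hM.core_le hc, fun b _ => by
    rw [commutatorElement_def]
    exact C.mul_mem (hCn.conj_mem _ hc b) (C.inv_mem hc)⟩
  rw [sup_eq_left.mpr hCD] at hMD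
  intro m hm b hb
  have := (hD.mp (hMD hm)).2 b hb
  rw [← commutatorElement_inv]
  exact C.inv_mem this

theorem le_of_isPGroup [Finite G] (hM : IsSocleOver H M) (hH : IsCoatom H) {p a : ℕ}
    (hp : p.Prime) (hidx : H.index = p ^ a) {B : Subgroup G} (hB : IsPGroup p B)
    (hBH : ∀ x ∈ H, ∀ b ∈ B, x * b * x⁻¹ ∈ B) : B ≤ M := fun b hb =>
  hM.mem_of_comm b fun m hm => hM.commutator_mem_of_isPGroup hH hp hidx hB hBH m hm b hb

end IsSocleOver

theorem le_of_not_dvd_relIndex {G : Type*} [Group G] [Finite G] {H N U : Subgroup G} [N.Normal]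
    {p a : ℕ}
    (hH : IsCoatom H) (hidx : H.index = p ^ a) (hU : U ≤ H) (h : ¬ p ∣ U.relIndex N) : N ≤ H := by
  by_contra hN
  have ha : a ≠ 0 := by
    rintro rfl
    rw [pow_zero, Subgroup.index_eq_one] at hidx
    exact hH.1 hidx
  apply h
  refine (dvd_pow_self p ha).trans ?_
  rw [← hidx, ← relIndex_eq_index_of_not_le hH hN]
  exact Subgroup.relIndex_dvd_of_le_left N hU

/-- The largest normal `p`-subgroup of `G`. -/
def pCore (p : ℕ) (G : Type*) [Group G] : Subgroup G :=
  sSup {N | N.Normal ∧ IsPGroup p N}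

theorem le_pCore {G : Type*} [Group G] {p : ℕ} {N : Subgroup G} (hN : N.Normal)
    (h : IsPGroup p N) : N ≤ pCore p G :=
  le_sSup ⟨hN, h⟩

theorem isPGroup_pCore (p : ℕ) (G : Type*) [Group G] : IsPGroup p (pCore p G) :=
  Sylow.sSup_of_normal _ (fun _ h => h.2) fun _ h => h.1

instance characteristic_pCore (p : ℕ) (G : Type*) [Group G] : (pCore p G).Characteristic := by
  refine Subgroup.characteristic_iff_map_le.mpr fun φ => ?_
  rw [pCore, sSup_eq_iSup, Subgroup.map_iSup]
  refine iSup_le fun N => ?_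
  rw [Subgroup.map_iSup]
  exact iSup_le fun hN => le_iSup₂_of_le (N.map φ.toMonoidHom)
    ⟨hN.1.map _ φ.surjective, hN.2.map _⟩ le_rfl

theorem le_pCore_of_normalized {G : Type*} [Group G] {p : ℕ} {B C : Subgroup G} [C.Normal]
    (hB : IsPGroup p B) (hBC : B ≤ C) (h : ∀ c ∈ C, ∀ b ∈ B, c * b * c⁻¹ ∈ B) :
    B ≤ pCore p G := by
  have h1 : B.subgroupOf C ≤ pCore p C := by
    refine le_pCore ⟨fun b hb c => h c c.2 b hb⟩ ?_
    exact hB.comap_subtype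
  have h2 : (pCore p C).map C.subtype ≤ pCore p G :=
    le_pCore inferInstance ((isPGroup_pCore p C).map _)
  exact fun b hb => h2 ⟨⟨b, hBC hb⟩, h1 hb, rfl⟩

theorem isCoatom_subgroupOf_iff {G : Type*} [Group G] {D L : Subgroup G} (hDL : D ≤ L) :
    IsCoatom (D.subgroupOf L) ↔ D ⋖ L := by
  constructor
  · intro h
    refine ⟨lt_of_le_of_ne hDL fun e => h.1 (by rw [e, Subgroup.subgroupOf_self]), ?_⟩
    intro B hDB hBL
    have := h.2 (B.subgroupOf L) (lt_of_le_of_ne (Subgroup.comap_mono hDB.le) fun e => ?_)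
    · rw [Subgroup.subgroupOf_eq_top] at this
      exact hBL.not_ge this
    · refine hDB.not_ge fun b hb => ?_
      have : (⟨b, hBL.le hb⟩ : L) ∈ B.subgroupOf L := hb
      rw [← e] at this
      exact this
  · intro h
    refine ⟨fun e => h.1.not_ge (Subgroup.subgroupOf_eq_top.mp e), fun B hB => ?_⟩
    have h1 : D < B.map L.subtype := by
      refine lt_of_le_of_ne (fun d hd => ⟨⟨d, hDL hd⟩, hB.le hd, rfl⟩) fun e => ?_
      refine hB.not_ge fun b hb => ?_
      change (b : G) ∈ D
      rw [e]
      exact ⟨b, hb, rfl⟩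
    have h2 : B.map L.subtype = L := by
      by_contra hne
      exact h.2 h1 (lt_of_le_of_ne (Subgroup.map_subtype_le B) hne)
    rw [eq_top_iff]
    intro x _
    obtain ⟨b, hb, e⟩ := h2.ge x.2
    exact (Subtype.ext e : b = x) ▸ hb

theorem inf_covBy_of_sup_eq_top {G : Type*} [Group G] {H D L : Subgroup G} [D.Normal]
    (hH : IsCoatom H) (hDH : D ≤ H) (hDL : D ⊔ L = ⊤) : H ⊓ L ⋖ L := by
  have hsplit : ∀ g : G, ∃ d ∈ D, ∃ l ∈ L, d * l = g := fun g => by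
    rw [← Subgroup.mem_sup_of_normal_left, hDL]; exact Subgroup.mem_top g
  have hH' : H ≤ D ⊔ (H ⊓ L) := by
    intro x hx
    obtain ⟨d, hd, l, hl, rfl⟩ := hsplit x
    refine Subgroup.mul_mem_sup hd ⟨?_, hl⟩
    simpa using H.mul_mem (H.inv_mem (hDH hd)) hx
  refine ⟨lt_of_le_of_ne inf_le_right fun e => hH.1 ?_, fun B hB hBL => ?_⟩
  · rw [eq_top_iff, ← hDL]
    exact sup_le hDH (inf_eq_right.mp e)
  · have h1 : H ≤ D ⊔ B := hH'.trans (sup_le_sup_left hB.le D)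
    rcases eq_or_lt_of_le h1 with h | h
    · exact hB.not_ge (le_inf (h ▸ le_sup_right) hBL.le)
    · have h2 := hH.2 _ h
      refine hBL.not_ge fun l hl => ?_
      have : l ∈ D ⊔ B := h2 ▸ Subgroup.mem_top l
      obtain ⟨d, hd, b, hb, rfl⟩ := Subgroup.mem_sup_of_normal_left.mp this
      refine B.mul_mem (hB.le ⟨hDH hd, ?_⟩) hb
      simpa using L.mul_mem hl (L.inv_mem (hBL.le hb))

theorem relIndex_eq_index_of_sup_eq_top {G : Type*} [Group G] [Finite G] {H D L : Subgroup G}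
    [D.Normal] (hDH : D ≤ H) (hDL : D ⊔ L = ⊤) : (H ⊓ L).relIndex L = H.index := by
  have hsplit : ∀ g : G, ∃ d ∈ D, ∃ l ∈ L, d * l = g := fun g => by
    rw [← Subgroup.mem_sup_of_normal_left, hDL]; exact Subgroup.mem_top g
  have hH' : (H ⊓ L) ⊔ D = H := by
    refine le_antisymm (sup_le inf_le_left hDH) ?_
    intro x hx
    obtain ⟨d, hd, l, hl, rfl⟩ := hsplit x
    rw [sup_comm]
    refine Subgroup.mul_mem_sup hd ⟨?_, hl⟩
    simpa using H.mul_mem (H.inv_mem (hDH hd)) hx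
  have h1 : D.relIndex L = D.index := by
    rw [← Subgroup.relIndex_sup_right, sup_comm, hDL, Subgroup.relIndex_top_right]
  have h2 : D.relIndex (H ⊓ L) = D.relIndex H := by
    rw [← Subgroup.relIndex_sup_right, hH']
  have h3 : (D ⊓ L).relIndex (H ⊓ L) * (H ⊓ L).relIndex L = D.relIndex L := by
    rw [Subgroup.relIndex_mul_relIndex _ _ _ (inf_le_inf_right L hDH) inf_le_right,
      Subgroup.inf_relIndex_right]
  have h4 : (D ⊓ L).relIndex (H ⊓ L) = D.relIndex (H ⊓ L) := by
    rw [← Subgroup.inf_relIndex_right (D ⊓ L), ← Subgroup.inf_relIndex_right D]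
    congr 1
    exact le_antisymm (le_inf (inf_le_left.trans inf_le_left) inf_le_right)
      (le_inf (le_inf inf_le_left (inf_le_right.trans inf_le_right)) inf_le_right)
  rw [h4, h2, h1, ← Subgroup.relIndex_mul_index hDH] at h3
  exact Nat.eq_of_mul_eq_mul_left (Nat.pos_of_ne_zero Subgroup.index_ne_zero_of_finite) h3

/-- In every solvable group of order less than `n`, the image of a maximal subgroup of `p`-power
index under an embedding is maximal. -/
def MaximalBelow.{u} (p n : ℕ) : Prop :=
  ∀ (G X : Type u) [Group G] [Finite G] [Group.IsSolvable G] [Group X] (i f : X →* G) (a : ℕ),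
    Nat.card G < n → Function.Injective i → Function.Injective f → IsCoatom i.range →
      i.range.index = p ^ a → IsCoatom f.range

theorem card_lt_of_ne_top {G : Type*} [Group G] [Finite G] {L : Subgroup G} (hL : L ≠ ⊤) :
    Nat.card L < Nat.card G :=
  lt_of_le_of_ne (Subgroup.card_le_card_group L) fun e => hL (Subgroup.eq_top_of_card_eq L e)

namespace MaximalBelow

universe u

variable {G : Type u} [Group G] [Finite G] [Group.IsSolvable G] {p a : ℕ} {H : Subgroup G}
  {f : H →* G}

theorem covBy_map (ih : MaximalBelow.{u} p (Nat.card G)) (hf : Function.Injective f)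
    {D L : Subgroup G} (hDH : D ≤ H) (hDL : D ⋖ L) (hL : L ≠ ⊤) (hidx : D.relIndex L = p ^ a)
    (hfL : ∀ x : H, (x : G) ∈ D → f x ∈ L) : (D.subgroupOf H).map f ⋖ L := by
  have hle : (D.subgroupOf H).map f ≤ L := by
    rintro _ ⟨x, hx, rfl⟩
    exact hfL x hx
  let i : D →* L := Subgroup.inclusion hDL.le
  let j : D →* L := (f.comp (Subgroup.inclusion hDH)).codRestrict L fun d => hfL _ d.2
  have hi : i.range = D.subgroupOf L := Subgroup.inclusion_range hDL.le
  have hj : j.range = ((D.subgroupOf H).map f).subgroupOf L := by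
    ext l
    constructor
    · rintro ⟨d, rfl⟩
      exact ⟨⟨d, hDH d.2⟩, d.2, rfl⟩
    · rintro ⟨x, hx, e⟩
      exact ⟨⟨x, hx⟩, Subtype.ext e⟩
  rw [← isCoatom_subgroupOf_iff hle, ← hj]
  refine ih L D i j a (card_lt_of_ne_top hL) (Subgroup.inclusion_injective _) ?_ ?_ ?_
  · intro x y e
    exact Subgroup.inclusion_injective hDH (hf (congrArg Subtype.val e))
  · rw [hi, isCoatom_subgroupOf_iff hDL.le]; exact hDL
  · rw [hi]; exact hidx

theorem isCoatom_range_of_normal (ih : MaximalBelow.{u} p (Nat.card G)) (hH : IsCoatom H)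
    (hidx : H.index = p ^ a) (hf : Function.Injective f) {N : Subgroup G} [N.Normal]
    (hN : N ≠ ⊥) (hNH : N ≤ H) (hfN : ∀ x : H, (x : G) ∈ N → f x ∈ N) : IsCoatom f.range := by
  have hmap : (N.subgroupOf H).map f = N := by
    refine Subgroup.eq_of_le_of_card_ge ?_ ?_
    · rintro _ ⟨x, hx, rfl⟩
      exact hfN x hx
    · rw [Subgroup.card_map_of_injective hf,
        Nat.card_congr (Subgroup.subgroupOfEquivOfLe hNH).toEquiv]
  have hiff : ∀ x : H, f x ∈ N ↔ (x : G) ∈ N := fun x => by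
    refine ⟨fun h => ?_, hfN x⟩
    rw [← hmap] at h
    obtain ⟨y, hy, e⟩ := h
    exact hf e ▸ hy
  have hNK : N ≤ f.range := by
    rw [← hmap]
    exact Subgroup.map_le_range _ _
  let π := QuotientGroup.mk' N
  have hker : ∀ x : H, x ∈ ((π.comp H.subtype).ker) ↔ π (f x) = 1 := fun x => by
    rw [MonoidHom.mem_ker]
    exact (QuotientGroup.eq_one_iff _).trans ((hiff x).symm.trans (QuotientGroup.eq_one_iff _).symm)
  let i := QuotientGroup.kerLift (π.comp H.subtype)
  let j : H ⧸ (π.comp H.subtype).ker →* G ⧸ N :=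
    QuotientGroup.lift _ (π.comp f) fun x hx => (hker x).mp hx
  have hi : i.range = H.map π := by
    rw [MonoidHom.range_eq_map, ← Subgroup.map_top_of_surjective _ (QuotientGroup.mk'_surjective _),
      Subgroup.map_map]
    change (⊤ : Subgroup H).map (π.comp H.subtype) = _
    rw [← Subgroup.map_map, ← MonoidHom.range_eq_map, Subgroup.range_subtype]
  have hj : j.range = f.range.map π := by
    rw [MonoidHom.range_eq_map, ← Subgroup.map_top_of_surjective _ (QuotientGroup.mk'_surjective _),
      Subgroup.map_map, MonoidHom.range_eq_map f, Subgroup.map_map]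
    rfl
  have hcoatom : ∀ S : Subgroup G, N ≤ S → (IsCoatom (S.map π) ↔ IsCoatom S) := by
    intro S hS
    have h1 : (S.map π).comap π = S := Subgroup.comap_map_eq_self (by
      rw [QuotientGroup.ker_mk']; exact hS)
    have hsurj := QuotientGroup.mk'_surjective N
    refine ⟨fun h => h1 ▸ Subgroup.isCoatom_comap_of_surjective hsurj h, fun h => ⟨fun e => h.1 ?_,
      fun B hB => ?_⟩⟩
    · rw [← h1, e, Subgroup.comap_top]
    · have h2 := h.2 (B.comap π) (by
        rw [← h1]; exact (Subgroup.comap_lt_comap_of_surjective hsurj).mpr hB)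
      rw [← Subgroup.map_comap_eq_self_of_surjective hsurj B, h2,
        Subgroup.map_top_of_surjective _ hsurj]
  rw [← hcoatom _ hNK, ← hj]
  refine ih (G ⧸ N) _ i j a ?_ (QuotientGroup.kerLift_injective _) ?_ ?_ ?_
  · rw [← Subgroup.index_eq_card]
    rw [← N.card_mul_index]
    have : 1 < Nat.card N := (Subgroup.one_lt_card_iff_ne_bot N).mpr hN
    have h2 : 0 < N.index := Nat.pos_of_ne_zero Subgroup.index_ne_zero_of_finite
    nlinarith
  · refine (injective_iff_map_eq_one j).mpr fun x hx => ?_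
    induction x using QuotientGroup.induction_on with
    | H x => exact (QuotientGroup.eq_one_iff x).mpr ((hker x).mpr hx)
  · rw [hi, hcoatom _ hNH]; exact hH
  · rw [hi, Subgroup.index_map_eq _ (QuotientGroup.mk'_surjective N) (by
      rw [QuotientGroup.ker_mk']; exact hNH)]
    exact hidx

end MaximalBelow

theorem index_range_eq_of_injective {G : Type*} [Group G] [Finite G] {H : Subgroup G} {f : H →* G}
    (hf : Function.Injective f) : f.range.index = H.index := by
  have h1 : Nat.card f.range = Nat.card H := by
    rw [Nat.card_congr (MonoidHom.ofInjective hf).toEquiv]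
  have h2 := H.card_mul_index
  rw [← f.range.card_mul_index, h1] at h2
  exact (Nat.eq_of_mul_eq_mul_left Nat.card_pos h2).symm

theorem card_inf_mul_relIndex {G : Type*} [Group G] (A B : Subgroup G) :
    Nat.card (A ⊓ B : Subgroup G) * A.relIndex B = Nat.card B := by
  rw [← Subgroup.inf_relIndex_right, ← Subgroup.relIndex_bot_left, ← Subgroup.relIndex_bot_left,
    Subgroup.relIndex_mul_relIndex _ _ _ bot_le inf_le_right]

theorem eq_of_le_of_index_eq {G : Type*} [Group G] [Finite G] {K L : Subgroup G} (h : K ≤ L)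
    (hidx : K.index = L.index) : K = L := by
  refine Subgroup.eq_of_le_of_card_ge h ?_
  have h2 := L.card_mul_index
  rw [← K.card_mul_index, hidx] at h2
  exact (Nat.eq_of_mul_eq_mul_right (Nat.pos_of_ne_zero Subgroup.index_ne_zero_of_finite) h2).le

theorem le_pCore_of_le_of_normalized {G : Type*} [Group G] [Finite G] [Group.IsSolvable G]
    {p a : ℕ} (hp : p.Prime) {H B : Subgroup G} (hH : IsCoatom H) (hidx : H.index = p ^ a)
    (hB : IsPGroup p B) (hBH : B ≤ H) (h : ∀ x ∈ H, ∀ b ∈ B, x * b * x⁻¹ ∈ B) :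
    B ≤ pCore p G := by
  obtain ⟨M, hM⟩ := exists_isSocleOver hH
  have h1 : B ≤ H.normalCore := hM.inf_eq ▸ le_inf (hM.le_of_isPGroup hH hp hidx hB h) hBH
  exact le_pCore_of_normalized hB h1 fun c hc => h c (H.normalCore_le hc)

namespace MaximalBelow

universe u

variable {G : Type u} [Group G] [Finite G] [Group.IsSolvable G] {p a : ℕ} {H : Subgroup G}
  {f : H →* G}

theorem isCoatom_range_of_not_pCore_le (ih : MaximalBelow.{u} p (Nat.card G)) (hp : p.Prime)
    (hH : IsCoatom H) (hidx : H.index = p ^ a) (hf : Function.Injective f)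
    (hU : ¬ pCore p G ≤ H) : IsCoatom f.range := by
  have hKidx : f.range.index = H.index := index_range_eq_of_injective hf
  have hKtop : f.range ≠ ⊤ := by
    intro h
    apply hH.1
    rw [← Subgroup.index_eq_one, ← hKidx, h, Subgroup.index_top]
  set U := pCore p G with hUdef
  have hUp : IsPGroup p U := isPGroup_pCore p G
  have hUn : U.Normal := inferInstance
  let B : Subgroup G := (U.comap f).map H.subtype
  have hBU : B ≤ U ⊓ H := by
    have hBH : B ≤ H := Subgroup.map_subtype_le _
    refine le_inf (le_pCore_of_le_of_normalized hp hH hidx ?_ hBH ?_) hBH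
    · exact (hUp.comap_of_injective f hf).map _
    · rintro x hx _ ⟨b, hb, rfl⟩
      refine ⟨⟨x, hx⟩ * b * ⟨x, hx⟩⁻¹, ?_, rfl⟩
      have := hUn.conj_mem _ hb (f ⟨x, hx⟩)
      simpa using this
  have hcard : Nat.card (f.range ⊓ U : Subgroup G) ≤ Nat.card (H ⊓ U : Subgroup G) := by
    have h1 : f.range ⊓ U = (U.comap f).map f := by
      rw [Subgroup.map_comap_eq]
    rw [h1, Subgroup.card_map_of_injective hf,
      ← Subgroup.card_map_of_injective H.subtype_injective, inf_comm]
    exact Subgroup.card_le_of_le hBU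
  have hrel : H.index ≤ f.range.relIndex U := by
    rw [← relIndex_eq_index_of_not_le hH hU]
    have e1 : Nat.card (f.range ⊓ U : Subgroup G) * f.range.relIndex U = Nat.card U := by
      exact card_inf_mul_relIndex _ _
    have e2 : Nat.card (H ⊓ U : Subgroup G) * H.relIndex U = Nat.card U := by
      exact card_inf_mul_relIndex _ _
    have e3 : Nat.card (H ⊓ U : Subgroup G) * H.relIndex U ≤
        Nat.card (H ⊓ U : Subgroup G) * f.range.relIndex U := by
      rw [e2, ← e1]
      exact Nat.mul_le_mul_right _ hcard
    exact Nat.le_of_mul_le_mul_left e3 Nat.card_pos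
  obtain ⟨L, hL, hKL⟩ : ∃ L, IsCoatom L ∧ f.range ≤ L :=
    (eq_top_or_exists_le_coatom f.range).resolve_left hKtop
  have hUL : ¬ U ≤ L := by
    intro h
    have h1 := Subgroup.relIndex_mul_index hKL
    have h2 : f.range.relIndex U ≤ f.range.relIndex L :=
      Subgroup.relIndex_le_of_le_right h Subgroup.index_ne_zero_of_finite
    have h3 : 1 < L.index := by
      have : L.index ≠ 0 := Subgroup.index_ne_zero_of_finite
      have : L.index ≠ 1 := fun e => hL.1 (Subgroup.index_eq_one.mp e)
      omega
    have h4 : 0 < f.range.relIndex L := Nat.pos_of_ne_zero Subgroup.index_ne_zero_of_finite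
    rw [hKidx] at h1
    nlinarith
  obtain ⟨M, hM⟩ := exists_isSocleOver hH
  have hMn := hM.normal
  have hUM : U ≤ M := hM.le_of_isPGroup hH hp hidx hUp fun x _ u hu => hUn.conj_mem u hu x
  suffices f.range = L from this ▸ hL
  by_cases hCL : H.normalCore ≤ L
  · have hML : ¬ M ≤ L := fun h => hUL (hUM.trans h)
    have hn : (M ⊓ L).Normal := by
      refine normal_of_conj_mem_of_sup hL hML (fun m hm x hx => ?_) fun y hy x hx =>
        ⟨hMn.conj_mem x hx.1 y, L.mul_mem (L.mul_mem hy hx.2) (L.inv_mem hy)⟩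
      have e : m * x * m⁻¹ = ⁅m, x⁆ * x := by rw [commutatorElement_def]; group
      have h1 := hM.comm m hm x hx.1
      rw [e]
      exact (M ⊓ L).mul_mem ⟨hM.core_le h1, hCL h1⟩ hx
    have hMLH : M ⊓ L ≤ H := by
      by_contra h
      exact hML ((hM.le_sup_core hH h).trans (sup_le inf_le_right hCL))
    have hMLC : M ⊓ L = H.normalCore :=
      le_antisymm (Subgroup.normal_le_normalCore.mpr hMLH) (le_inf hM.core_le hCL)
    refine eq_of_le_of_index_eq hKL ?_
    rw [hKidx, ← hM.relIndex_eq hH, ← relIndex_eq_index_of_not_le hL hML, ← hMLC,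
      Subgroup.inf_relIndex_left]
  · have hsup : H.normalCore ⊔ L = ⊤ := sup_eq_top_of_not_le hL hCL
    have hcov := inf_covBy_of_sup_eq_top hH H.normalCore_le hsup
    have hidx' := relIndex_eq_index_of_sup_eq_top H.normalCore_le hsup
    have h1 := ih.covBy_map hf inf_le_left hcov hL.1 (hidx'.trans hidx) fun x _ =>
      hKL ⟨x, rfl⟩
    refine (h1.eq_or_eq (Subgroup.map_le_range _ _) hKL).resolve_left fun e => hCL ?_
    refine H.normalCore_le.trans fun x hx => ?_
    have h2 : f ⟨x, hx⟩ ∈ ((H ⊓ L).subgroupOf H).map f := e ▸ ⟨_, rfl⟩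
    obtain ⟨y, hy, e⟩ := h2
    rw [hf e] at hy
    exact hy.2

end MaximalBelow

/-- `z` lies in a normal `p`-by-`r` subgroup of `G`, that is, in `O_{p,r}(G)`. -/
def InPRCore (p r : ℕ) {G : Type*} [Group G] (z : G) : Prop :=
  ∃ N B : Subgroup G, N.Normal ∧ B.Normal ∧ B ≤ N ∧ IsPGroup p B ∧ z ∈ N ∧
    ∀ n ∈ N, ∃ k, n ^ r ^ k ∈ B

namespace InPRCore

variable {G : Type*} [Group G] {p r : ℕ}

theorem subgroup {S : Subgroup G} {z : S} (h : InPRCore p r (z : G)) : InPRCore p r z := by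
  obtain ⟨N, B, hN, hB, hBN, hBp, hz, hNB⟩ := h
  exact ⟨N.subgroupOf S, B.subgroupOf S, inferInstance, inferInstance, Subgroup.comap_mono hBN,
    hBp.comap_subtype, hz, fun n hn => hNB n hn⟩

theorem of_equiv {G' : Type*} [Group G'] (φ : G' ≃* G) {z : G'} (h : InPRCore p r (φ z)) :
    InPRCore p r z := by
  obtain ⟨N, B, hN, hB, hBN, hBp, hz, hNB⟩ := h
  refine ⟨N.comap φ.toMonoidHom, B.comap φ.toMonoidHom, inferInstance, inferInstance,
    Subgroup.comap_mono hBN, hBp.comap_of_injective _ φ.injective, hz, fun n hn => ?_⟩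
  obtain ⟨k, hk⟩ := hNB _ hn
  refine ⟨k, ?_⟩
  change φ (n ^ r ^ k) ∈ B
  rw [map_pow]
  exact hk

theorem mem_normalCore [Finite G] {a : ℕ} (hp : p.Prime) (hr : r.Prime) (hpr : r ≠ p)
    {H : Subgroup G} (hH : IsCoatom H) (hidx : H.index = p ^ a) (hU : pCore p G ≤ H) {z : G}
    (h : InPRCore p r z) : z ∈ H.normalCore := by
  obtain ⟨N, B, hN, hB, hBN, hBp, hz, hNB⟩ := h
  have hNH : N ≤ H := by
    refine le_of_not_dvd_relIndex hH hidx ((le_pCore hB hBp).trans hU) fun hdvd => ?_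
    have : Fact r.Prime := ⟨hr⟩
    have h1 : IsPGroup r (N.map (QuotientGroup.mk' B)) := by
      rintro ⟨_, n, hn, rfl⟩
      obtain ⟨k, hk⟩ := hNB n hn
      exact ⟨k, Subtype.ext ((QuotientGroup.eq_one_iff (n ^ r ^ k)).mpr hk)⟩
    obtain ⟨k, hk⟩ := IsPGroup.iff_card.mp h1
    rw [← Subgroup.relIndex_ker, QuotientGroup.ker_mk'] at hk
    rw [hk] at hdvd
    exact hpr ((Nat.prime_dvd_prime_iff_eq hp hr).mp (hp.dvd_of_dvd_pow hdvd)).symm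
  exact Subgroup.normal_le_normalCore.mpr hNH hz

end InPRCore

theorem comap_mk_pCore_le {G : Type*} [Group G] {p : ℕ} {E : Subgroup (G ⧸ pCore p G)}
    (hE : E.Normal) (hp : IsPGroup p E) : E.comap (QuotientGroup.mk' _) ≤ pCore p G :=
  le_pCore inferInstance (hp.comap_of_ker_isPGroup _ (by
    rw [QuotientGroup.ker_mk']; exact isPGroup_pCore p G))

theorem comap_mk_le_of_isPGroup {G : Type*} [Group G] [Finite G] {p s a : ℕ} (hp : p.Prime)
    (hs : s.Prime) (hps : s ≠ p) {H : Subgroup G} (hH : IsCoatom H) (hidx : H.index = p ^ a)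
    (hU : pCore p G ≤ H) {E : Subgroup (G ⧸ pCore p G)} (hE : E.Normal) (hEs : IsPGroup s E) :
    E.comap (QuotientGroup.mk' _) ≤ H := by
  intro n hn
  refine H.normalCore_le (InPRCore.mem_normalCore hp hs hps hH hidx hU
    ⟨E.comap (QuotientGroup.mk' _), pCore p G, inferInstance, inferInstance, ?_,
      isPGroup_pCore p G, hn, ?_⟩)
  · intro u hu
    rw [Subgroup.mem_comap, QuotientGroup.mk'_apply, (QuotientGroup.eq_one_iff u).mpr hu]
    exact E.one_mem
  · intro n hn
    obtain ⟨k, hk⟩ := hEs ⟨_, hn⟩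
    exact ⟨k, (QuotientGroup.eq_one_iff _).mp (congrArg Subtype.val hk)⟩

theorem exists_pCore_ne_bot (G : Type*) [Group G] [Finite G] [Group.IsSolvable G] [Nontrivial G] :
    ∃ r, r.Prime ∧ pCore r G ≠ ⊥ := by
  by_contra! h
  obtain ⟨r, hr, hdvd⟩ := Nat.exists_prime_and_dvd (Finite.one_lt_card (α := G)).ne'
  have : Fact r.Prime := ⟨hr⟩
  obtain ⟨x, hx⟩ := exists_prime_orderOf_dvd_card' r hdvd
  obtain ⟨D, hD, hDp, hxD⟩ := exists_normal_pGroup_of_commute (r := r) (x := x)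
    ⟨1, by rw [pow_one, ← hx, pow_orderOf_eq_one]⟩ (by
      intro s hs N hN hNs n hn
      have := le_pCore hN hNs hn
      rw [h s hs, Subgroup.mem_bot] at this
      rw [this, mul_one, one_mul])
  have := le_pCore hD hDp hxD
  rw [h r hr, Subgroup.mem_bot] at this
  rw [this, orderOf_one] at hx
  exact hr.one_lt.ne hx

/-- The elements of order dividing `r` in the centre of `T` that lie in `O_{p,r}(G)`. -/
def centralPRCore (p r : ℕ) {G : Type*} [Group G] (T : Subgroup G) : Set G :=
  {z | z ∈ T ∧ (∀ t ∈ T, z * t = t * z) ∧ z ^ r = 1 ∧ InPRCore p r z}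

theorem inPRCore_of_subgroup {G : Type*} [Group G] [Finite G] [Group.IsSolvable G] {p r a : ℕ}
    (hp : p.Prime) (hr : r.Prime) {H : Subgroup G} (hH : IsCoatom H) (hidx : H.index = p ^ a)
    (hU : pCore p G ≤ H) (T : Sylow r G) {z : H} (hzT : ∀ t ∈ T, (z : G) * t = t * z)
    (hzr : z ^ r = 1) (hz : InPRCore p r z) : InPRCore p r (z : G) := by
  have : Fact r.Prime := ⟨hr⟩
  obtain ⟨N, B, hN, hB, hBN, hBp, hzN, hNB⟩ := hz
  have hBU : B.map H.subtype ≤ pCore p G := by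
    refine le_pCore_of_le_of_normalized hp hH hidx (hBp.map _) (Subgroup.map_subtype_le _) ?_
    rintro x hx _ ⟨b, hb, rfl⟩
    exact ⟨⟨x, hx⟩ * b * ⟨x, hx⟩⁻¹, hB.conj_mem b hb _, rfl⟩
  set U := pCore p G with hUdef
  have hcomm : ∀ s, s.Prime → ∀ E : Subgroup (G ⧸ U), E.Normal → IsPGroup s E → ∀ n ∈ E,
      ((z : G) : G ⧸ U) * n = n * ((z : G) : G ⧸ U) := by
    intro s hs E hE hEs n hn
    induction n using QuotientGroup.induction_on with
    | H n =>
    by_cases hsp : s = p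
    · subst hsp
      have := comap_mk_pCore_le hE hEs hn
      rw [(QuotientGroup.eq_one_iff n).mpr this, mul_one, one_mul]
    by_cases hsr : s = r
    · subst hsr
      have h1 : E ≤ (T.mapSurjective (QuotientGroup.mk'_surjective U) : Subgroup (G ⧸ U)) :=
        hEs.le_sylow_of_normal _
      obtain ⟨t, ht, e⟩ := h1 hn
      rw [← e]
      exact congrArg (QuotientGroup.mk' U) (hzT t ht)
    · have hnH := comap_mk_le_of_isPGroup hp hs hsp hH hidx hU hE hEs hn
      rw [← commutatorElement_eq_one_iff_mul_comm]
      obtain ⟨k, hk⟩ : ∃ k, ⁅(z : G), n⁆ ^ s ^ k ∈ U := by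
        have h1 : ⁅((z : G) : G ⧸ U), (n : G ⧸ U)⁆ ∈ E := by
          rw [commutatorElement_def]
          exact E.mul_mem (hE.conj_mem _ hn _) (E.inv_mem hn)
        obtain ⟨k, hk⟩ := hEs ⟨_, h1⟩
        exact ⟨k, (QuotientGroup.eq_one_iff _).mp (congrArg Subtype.val hk)⟩
      obtain ⟨j, hj⟩ : ∃ j, ⁅(z : G), n⁆ ^ r ^ j ∈ U := by
        have h1 : ⁅z, (⟨n, hnH⟩ : H)⁆ ∈ N := by
          rw [commutatorElement_def, mul_assoc, mul_assoc, ← mul_assoc (⟨n, hnH⟩ : H)]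
          exact N.mul_mem hzN (hN.conj_mem _ (N.inv_mem hzN) _)
        obtain ⟨j, hj⟩ := hNB _ h1
        exact ⟨j, hBU ⟨_, hj, rfl⟩⟩
      exact (QuotientGroup.eq_one_iff _).mpr (mem_of_pow_mem_of_coprime
        (Nat.Coprime.pow k j ((Nat.coprime_primes hs hr).mpr hsr)) hk hj)
  obtain ⟨D, hD, hDr, hzD⟩ := exists_normal_pGroup_of_commute (r := r)
    (x := ((z : G) : G ⧸ U)) ⟨1, by
      rw [pow_one, ← QuotientGroup.mk_pow, ← Subgroup.coe_pow, hzr]; rfl⟩ hcomm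
  refine ⟨D.comap (QuotientGroup.mk' U), U, inferInstance, inferInstance, fun u hu => ?_,
    isPGroup_pCore p G, hzD, fun n hn => ?_⟩
  · rw [Subgroup.mem_comap, QuotientGroup.mk'_apply, (QuotientGroup.eq_one_iff u).mpr hu]
    exact D.one_mem
  · obtain ⟨k, hk⟩ := hDr ⟨_, hn⟩
    exact ⟨k, (QuotientGroup.eq_one_iff _).mp (congrArg Subtype.val hk)⟩

theorem map_mem_centralPRCore {G : Type*} [Group G] [Finite G] [Group.IsSolvable G] {p r a : ℕ}
    (hp : p.Prime) (hr : r.Prime) {H : Subgroup G} (hH : IsCoatom H) (hidx : H.index = p ^ a)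
    (hU : pCore p G ≤ H) (T : Sylow r G) {f : H →* G} (hf : Function.Injective f)
    (hTH : (T : Subgroup G) ≤ H) (hfT : ((T : Subgroup G).subgroupOf H).map f = T) {x : H}
    (hx : (x : G) ∈ centralPRCore p r (T : Subgroup G)) :
    f x ∈ centralPRCore p r (T : Subgroup G) := by
  set ω := centralPRCore p r (T : Subgroup G) with hω
  let S : Set H := {x | (x : G) ∈ ω}
  have h1 : ω ⊆ f '' S := by
    rintro w ⟨hwT, hwc, hwr, hwPR⟩
    obtain ⟨x, hxT, rfl⟩ := hfT.ge hwT
    refine ⟨x, ?_, rfl⟩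
    have hxc : ∀ t ∈ (T : Subgroup G), (x : G) * t = t * x := by
      intro t ht
      have h2 : f ⟨t, hTH ht⟩ ∈ (T : Subgroup G) := hfT.le ⟨_, ht, rfl⟩
      have h3 := hwc _ h2
      rw [← map_mul, ← map_mul] at h3
      exact congrArg Subtype.val (hf h3)
    have hxr : x ^ r = 1 := hf (by rw [map_pow, hwr, map_one])
    refine ⟨hxT, hxc, by rw [← Subgroup.coe_pow, hxr, Subgroup.coe_one], ?_⟩
    refine inPRCore_of_subgroup hp hr hH hidx hU T hxc hxr ?_
    refine InPRCore.of_equiv (MonoidHom.ofInjective hf) ?_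
    exact InPRCore.subgroup hwPR
  have h2 : (f '' S).ncard ≤ ω.ncard := by
    rw [Set.ncard_image_of_injective S hf, ← Set.ncard_image_of_injective S H.subtype_injective]
    refine Set.ncard_le_ncard ?_ (Set.toFinite _)
    rintro _ ⟨y, hy, rfl⟩
    exact hy
  rw [Set.eq_of_subset_of_ncard_le h1 h2 (Set.toFinite _)]
  exact ⟨x, hx, rfl⟩

theorem exists_mem_centralPRCore {G : Type*} [Group G] [Finite G] {p r : ℕ} (hr : r.Prime)
    (T : Sylow r G) (h : pCore r (G ⧸ pCore p G) ≠ ⊥) :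
    ∃ z ∈ centralPRCore p r (T : Subgroup G), z ≠ 1 := by
  have : Fact r.Prime := ⟨hr⟩
  set U := pCore p G with hU
  set E := (pCore r (G ⧸ U)).comap (QuotientGroup.mk' U) with hE
  obtain ⟨e, he, hne⟩ := (Subgroup.bot_or_exists_ne_one (pCore r (G ⧸ U))).resolve_left h
  have h1 : pCore r (G ⧸ U) ≤ (T.mapSurjective (QuotientGroup.mk'_surjective U) :
      Subgroup (G ⧸ U)) := (isPGroup_pCore r _).le_sylow_of_normal _
  obtain ⟨t, ht, e1⟩ := h1 he
  have htE : t ∈ E := by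
    rw [hE, Subgroup.mem_comap, e1]; exact he
  have ht1 : t ≠ 1 := by
    rintro rfl
    exact hne (by rw [← e1, map_one])
  have hdvd : r ∣ Nat.card ((T : Subgroup G) ⊓ E : Subgroup G) := by
    rcases (T.isPGroup'.to_inf_left (K := E)).card_eq_or_dvd with h | h
    · rw [Subgroup.card_eq_one] at h
      have : t ∈ (T : Subgroup G) ⊓ E := ⟨ht, htE⟩
      rw [h] at this
      exact absurd this ht1
    · exact h
  obtain ⟨y, hy, hy1, hyc⟩ := exists_fixed_ne_one_of_dvd_card hr T.isPGroup'
    (MulAut.conj.comp (T : Subgroup G).subtype) ((T : Subgroup G) ⊓ E) (fun g d hd =>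
      ⟨(T : Subgroup G).mul_mem ((T : Subgroup G).mul_mem g.2 hd.1)
        ((T : Subgroup G).inv_mem g.2),
        (inferInstance : E.Normal).conj_mem d hd.2 g⟩) hdvd
  obtain ⟨k, hk⟩ := IsPGroup.iff_orderOf.mp T.isPGroup' ⟨y, hy.1⟩
  rw [Subgroup.orderOf_mk] at hk
  have hk0 : k ≠ 0 := by
    rintro rfl
    exact hy1 (orderOf_eq_one_iff.mp (by rw [hk, pow_zero]))
  have hord : orderOf (y ^ (orderOf y / r)) = r :=
    orderOf_pow_orderOf_div (orderOf_pos y).ne' (hk ▸ dvd_pow_self r hk0)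
  refine ⟨y ^ (orderOf y / r), ⟨(T : Subgroup G).pow_mem hy.1 _, fun t ht => ?_, ?_, E, U,
    inferInstance, inferInstance, ?_, isPGroup_pCore p G, E.pow_mem hy.2 _, ?_⟩, ?_⟩
  · have h2 : t * y * t⁻¹ = y := hyc ⟨t, ht⟩
    have h3 : Commute y t := (mul_inv_eq_iff_eq_mul.mp h2).symm
    exact (h3.pow_left _).eq
  · exact orderOf_dvd_iff_pow_eq_one.mp hord.dvd
  · intro u hu
    rw [hE, Subgroup.mem_comap, QuotientGroup.mk'_apply, (QuotientGroup.eq_one_iff u).mpr hu]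
    exact Subgroup.one_mem _
  · intro n hn
    obtain ⟨k, hk⟩ := isPGroup_pCore r (G ⧸ U) ⟨_, hn⟩
    exact ⟨k, (QuotientGroup.eq_one_iff _).mp (congrArg Subtype.val hk)⟩
  · intro h
    rw [h, orderOf_one] at hord
    exact hr.one_lt.ne hord

/-- `A` is an abelian subgroup of exponent dividing `r`. -/
def IsElemAb {G : Type*} [Group G] (r : ℕ) (A : Subgroup G) : Prop :=
  (∀ a ∈ A, ∀ b ∈ A, a * b = b * a) ∧ ∀ a ∈ A, a ^ r = 1

/-- `A` is an elementary abelian `r`-subgroup of `T` of largest order. -/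
def IsMaxElemAb {G : Type*} [Group G] (r : ℕ) (T A : Subgroup G) : Prop :=
  A ≤ T ∧ IsElemAb r A ∧ ∀ B ≤ T, IsElemAb r B → Nat.card B ≤ Nat.card A

/-- The Thompson subgroup of `T`, generated by the elementary abelian subgroups of largest
order. -/
def thompson {G : Type*} [Group G] (r : ℕ) (T : Subgroup G) : Subgroup G :=
  sSup {A | IsMaxElemAb r T A}

section

variable {G : Type*} [Group G] {r : ℕ} {T : Subgroup G}

theorem IsElemAb.map {S A : Subgroup G} (hA : IsElemAb r A) (φ : S →* G) :
    IsElemAb r ((A.subgroupOf S).map φ) := by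
  constructor
  · rintro _ ⟨a, ha, rfl⟩ _ ⟨b, hb, rfl⟩
    have h : a * b = b * a := Subtype.ext (hA.1 a ha b hb)
    rw [← map_mul, ← map_mul, h]
  · rintro _ ⟨a, ha, rfl⟩
    have h : a ^ r = 1 := Subtype.ext (hA.2 a ha)
    rw [← map_pow, h, map_one]

theorem exists_isMaxElemAb [Finite G] (r : ℕ) (T : Subgroup G) : ∃ A, IsMaxElemAb r T A := by
  have h0 : ∃ A : Subgroup G, A ≤ T ∧ IsElemAb r A := by
    refine ⟨⊥, bot_le, ?_, ?_⟩ <;> simp +contextual [Subgroup.mem_bot]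
  obtain ⟨A, hA, hmax⟩ := Set.exists_max_image {A : Subgroup G | A ≤ T ∧ IsElemAb r A}
    (fun A => Nat.card A) (Set.toFinite _) h0
  exact ⟨A, hA.1, hA.2, fun B hB hB' => hmax B ⟨hB, hB'⟩⟩

theorem thompson_le : thompson r T ≤ T :=
  sSup_le fun _ h => h.1

theorem thompson_ne_bot [Finite G] {z : G} (hz : z ∈ T) (hz1 : z ≠ 1)
    (hzr : z ^ r = 1) : thompson r T ≠ ⊥ := by
  obtain ⟨A, hA⟩ := exists_isMaxElemAb r T
  intro h
  have h1 : A ≤ thompson r T := le_sSup hA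
  rw [h, le_bot_iff] at h1
  have h2 := hA.2.2 (Subgroup.zpowers z) (by rwa [Subgroup.zpowers_le]) (by
    constructor
    · rintro _ ⟨i, rfl⟩ _ ⟨j, rfl⟩
      exact ((Commute.refl z).zpow_zpow i j).eq
    · rintro _ ⟨i, rfl⟩
      change (z ^ i) ^ r = 1
      rw [← zpow_natCast, zpow_comm, zpow_natCast, hzr, one_zpow])
  rw [h1, Subgroup.card_bot, Nat.card_zpowers] at h2
  have h3 := orderOf_pos z
  exact hz1 (orderOf_eq_one_iff.mp (by omega))

theorem map_mem_thompson {S : Subgroup G} [Finite G] (hTS : T ≤ S) {φ : S →* G}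
    (hφ : Function.Injective φ) (hφT : ∀ x : S, (x : G) ∈ T → φ x ∈ T) {x : S}
    (hx : (x : G) ∈ thompson r T) : φ x ∈ thompson r T := by
  have h : thompson r T ≤ ((thompson r T).comap φ).map S.subtype := by
    refine sSup_le fun A hA a ha => ?_
    refine ⟨⟨a, hTS (hA.1 ha)⟩, ?_, rfl⟩
    have h1 : IsMaxElemAb r T ((A.subgroupOf S).map φ) := by
      refine ⟨?_, hA.2.1.map φ, ?_⟩
      · rintro _ ⟨y, hy, rfl⟩
        exact hφT y (hA.1 hy)
      · rw [Subgroup.card_map_of_injective hφ,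
          Nat.card_congr (Subgroup.subgroupOfEquivOfLe (hA.1.trans hTS)).toEquiv]
        exact hA.2.2
    have h2 : (A.subgroupOf S).map φ ≤ thompson r T := le_sSup h1
    exact h2 ⟨_, ha, rfl⟩
  obtain ⟨y, hy, e⟩ := h hx
  rw [← Subtype.ext e]
  exact hy

theorem conj_mem_thompson [Finite G] {g : G} (hg : ∀ t ∈ T, g * t * g⁻¹ ∈ T) {x : G}
    (hx : x ∈ thompson r T) : g * x * g⁻¹ ∈ thompson r T :=
  map_mem_thompson (S := ⊤) le_top (φ := (MulAut.conj g).toMonoidHom.comp (Subgroup.subtype ⊤))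
    ((MulAut.conj g).injective.comp Subtype.coe_injective) (fun x hx => hg x hx)
    (x := ⟨x, Subgroup.mem_top x⟩) hx

theorem thompson_eq_of_le [Finite G] {T₀ : Subgroup G} (h0 : T₀ ≤ T) (h : thompson r T ≤ T₀) :
    thompson r T₀ = thompson r T := by
  obtain ⟨A, hA⟩ := exists_isMaxElemAb r T
  have hA0 : A ≤ T₀ := (le_sSup hA : A ≤ thompson r T).trans h
  unfold thompson
  congr 1
  ext B
  constructor
  · rintro ⟨h1, h2, h3⟩
    exact ⟨h1.trans h0, h2, fun D hD hD' => (hA.2.2 D hD hD').trans (h3 A hA0 hA.2.1)⟩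
  · intro hB
    exact ⟨(le_sSup hB : B ≤ thompson r T).trans h, hB.2.1, fun D hD => hB.2.2 D (hD.trans h0)⟩

end

theorem relIndex_dvd_index_of_normal_right {G : Type*} [Group G] [Finite G] (T C : Subgroup G)
    [C.Normal] : T.relIndex C ∣ T.index := by
  have h1 : C.relIndex T * (T ⊔ C).index = C.index := by
    rw [← Subgroup.relIndex_sup_right, Subgroup.relIndex_mul_index le_sup_right]
  have h2 : T.relIndex C * C.index = C.relIndex T * T.index := by
    rw [← Subgroup.inf_relIndex_right T C, Subgroup.relIndex_mul_index inf_le_right,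
      ← Subgroup.inf_relIndex_right C T, Subgroup.relIndex_mul_index inf_le_right, inf_comm]
  rw [← h1, mul_left_comm] at h2
  exact ⟨_, (Nat.eq_of_mul_eq_mul_left (Nat.pos_of_ne_zero Subgroup.index_ne_zero_of_finite)
    h2).symm⟩

theorem normalizer_inf_sup_eq_top {G : Type*} [Group G] [Finite G] {r : ℕ} (hr : r.Prime)
    (T : Sylow r G) (C : Subgroup G) [C.Normal] :
    Subgroup.normalizer (((T : Subgroup G) ⊓ C : Subgroup G) : Set G) ⊔ C = ⊤ := by
  have : Fact r.Prime := ⟨hr⟩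
  have h1 : IsPGroup r ((T : Subgroup G).subgroupOf C) := T.isPGroup'.comap_subtype
  have h2 : ¬ r ∣ ((T : Subgroup G).subgroupOf C).index := fun h =>
    T.not_dvd_index (h.trans (relIndex_dvd_index_of_normal_right _ C))
  have h3 := Sylow.normalizer_sup_eq_top (h1.toSylow h2)
  rw [IsPGroup.toSylow_coe, Subgroup.subgroupOf_map_subtype] at h3
  exact h3

theorem mem_normalizer_of_forall_conj_mem {G : Type*} [Group G] [Finite G] {J : Subgroup G} {g : G}
    (h : ∀ x ∈ J, g * x * g⁻¹ ∈ J) : g ∈ Subgroup.normalizer (J : Set G) := by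
  have h1 : J.map (MulAut.conj g).toMonoidHom = J := by
    refine Subgroup.eq_of_le_of_card_ge ?_
      (Subgroup.card_map_of_injective (MulAut.conj g).injective).ge
    rintro _ ⟨x, hx, rfl⟩
    exact h x hx
  refine Subgroup.mem_normalizer_iff.mpr fun x => ⟨h x, fun hx => ?_⟩
  obtain ⟨y, hy, e⟩ := h1.ge hx
  exact (MulAut.conj g).injective e ▸ hy

namespace MaximalBelow

universe u

variable {G : Type u} [Group G] [Finite G] [Group.IsSolvable G] {p a : ℕ} {H : Subgroup G}
  {f : H →* G}

theorem isCoatom_range_of_sup_normalizer (ih : MaximalBelow.{u} p (Nat.card G))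
    (hH : IsCoatom H) (hidx : H.index = p ^ a) (hf : Function.Injective f) {J : Subgroup G}
    (hJ : J ≠ ⊥) (hJC : J ≤ H) (hfJ : ∀ x : H, (x : G) ∈ J → f x ∈ J)
    (hN : H.normalCore ⊔ Subgroup.normalizer (J : Set G) = ⊤) : IsCoatom f.range := by
  set L := Subgroup.normalizer (J : Set G) with hL
  by_cases hLtop : L = ⊤
  · have : J.Normal := Subgroup.normalizer_eq_top_iff.mp hLtop
    exact ih.isCoatom_range_of_normal hH hidx hf hJ hJC hfJ
  have hmap : (J.subgroupOf H).map f = J := by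
    refine Subgroup.eq_of_le_of_card_ge ?_ ?_
    · rintro _ ⟨x, hx, rfl⟩
      exact hfJ x hx
    · rw [Subgroup.card_map_of_injective hf,
        Nat.card_congr (Subgroup.subgroupOfEquivOfLe hJC).toEquiv]
  have hfL : ∀ x : H, f x ∈ L ↔ (x : G) ∈ L := by
    intro x
    constructor
    · intro h
      refine mem_normalizer_of_forall_conj_mem fun y hy => ?_
      have h1 := (Subgroup.mem_normalizer_iff.mp h _).mp (hfJ ⟨y, hJC hy⟩ hy)
      rw [← map_mul, ← map_inv, ← map_mul] at h1
      obtain ⟨z, hz, e⟩ := hmap.ge h1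
      have := hf e
      rw [this] at hz
      exact hz
    · intro h
      refine mem_normalizer_of_forall_conj_mem fun y hy => ?_
      obtain ⟨z, hz, rfl⟩ := hmap.ge hy
      rw [← map_mul, ← map_inv, ← map_mul]
      exact hfJ _ ((Subgroup.mem_normalizer_iff.mp h _).mp hz)
  have hcov := inf_covBy_of_sup_eq_top hH H.normalCore_le hN
  have hrel := relIndex_eq_index_of_sup_eq_top H.normalCore_le hN
  have h1 := ih.covBy_map hf inf_le_left hcov hLtop (hrel.trans hidx) fun x hx =>
    (hfL x).mpr hx.2
  have hK1 : ((H ⊓ L).subgroupOf H).map f = f.range ⊓ L := by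
    ext y
    constructor
    · rintro ⟨x, hx, rfl⟩
      exact ⟨⟨x, rfl⟩, (hfL x).mpr hx.2⟩
    · rintro ⟨⟨x, rfl⟩, hx⟩
      exact ⟨x, ⟨x.2, (hfL x).mp hx⟩, rfl⟩
  have hKL : f.range.relIndex L = f.range.index := by
    rw [index_range_eq_of_injective hf, ← hrel, Subgroup.inf_relIndex_right]
    have e1 := card_inf_mul_relIndex f.range L
    have e2 := card_inf_mul_relIndex H L
    rw [← hK1, Subgroup.card_map_of_injective hf,
      Nat.card_congr (Subgroup.subgroupOfEquivOfLe inf_le_left).toEquiv, ← e2] at e1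
    exact Nat.eq_of_mul_eq_mul_left Nat.card_pos e1
  rw [hK1] at h1
  have hKtop : f.range ≠ ⊤ := by
    intro h
    apply hH.1
    rw [← Subgroup.index_eq_one, ← index_range_eq_of_injective hf, h, Subgroup.index_top]
  refine ⟨hKtop, fun B hB => ?_⟩
  rcases h1.eq_or_eq (inf_le_inf_right L hB.le) inf_le_right with h | h
  · refine absurd (eq_of_le_of_index_eq hB.le (le_antisymm ?_ ?_)) hB.ne
    · rw [← hKL, ← Subgroup.inf_relIndex_right, ← h, Subgroup.inf_relIndex_right]
      rw [← Subgroup.relIndex_top_right]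
      exact Subgroup.relIndex_le_of_le_right le_top Subgroup.index_ne_zero_of_finite
    · exact Nat.le_of_dvd (Nat.pos_of_ne_zero Subgroup.index_ne_zero_of_finite)
        (Subgroup.index_dvd_of_le hB.le)
  · have hLB : L ≤ B := inf_eq_right.mp h
    have e1 := Subgroup.relIndex_mul_index hB.le
    have e2 : f.range.relIndex L ≤ f.range.relIndex B :=
      Subgroup.relIndex_le_of_le_right hLB Subgroup.index_ne_zero_of_finite
    have e3 : 0 < f.range.relIndex B := Nat.pos_of_ne_zero Subgroup.index_ne_zero_of_finite
    have e4 : B.index ≠ 0 := Subgroup.index_ne_zero_of_finite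
    rw [hKL] at e2
    rw [← Subgroup.index_eq_one]
    by_contra hne
    have : 2 ≤ B.index := by omega
    nlinarith

theorem isCoatom_range_of_thompson_le (ih : MaximalBelow.{u} p (Nat.card G))
    (hH : IsCoatom H) (hidx : H.index = p ^ a) (hf : Function.Injective f) {r : ℕ}
    (hr : r.Prime) (T : Sylow r G) (hTH : (T : Subgroup G) ≤ H)
    (hfT : ((T : Subgroup G).subgroupOf H).map f = T)
    (hJ : thompson r (T : Subgroup G) ≠ ⊥) (hJC : thompson r (T : Subgroup G) ≤ H.normalCore) :
    IsCoatom f.range := by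
  refine ih.isCoatom_range_of_sup_normalizer hH hidx hf hJ (hJC.trans H.normalCore_le)
    (fun x hx => map_mem_thompson hTH hf (fun y hy => hfT.le ⟨y, hy, rfl⟩) hx) ?_
  rw [eq_top_iff, ← normalizer_inf_sup_eq_top hr T H.normalCore, sup_comm]
  refine sup_le_sup_left (fun g hg => ?_) _
  refine mem_normalizer_of_forall_conj_mem fun x hx => ?_
  rw [← thompson_eq_of_le (T₀ := (T : Subgroup G) ⊓ H.normalCore) inf_le_left
    (le_inf thompson_le hJC)] at hx ⊢
  exact conj_mem_thompson (fun t ht => (Subgroup.mem_normalizer_iff.mp hg t).mp ht) hx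

end MaximalBelow

theorem IsElemAb.mono {G : Type*} [Group G] {r : ℕ} {A B : Subgroup G} (hB : IsElemAb r B)
    (h : A ≤ B) : IsElemAb r A :=
  ⟨fun a ha b hb => hB.1 a (h ha) b (h hb), fun a ha => hB.2 a (h ha)⟩

theorem IsElemAb.sup {G : Type*} [Group G] {r : ℕ} {A B : Subgroup G} (hA : IsElemAb r A)
    (hB : IsElemAb r B) (hAB : ∀ a ∈ A, ∀ b ∈ B, a * b = b * a) : IsElemAb r (A ⊔ B) := by
  have h1 : A ⊔ B ≤ Subgroup.centralizer ((A : Set G) ∪ B) := by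
    refine sup_le (fun a ha => Subgroup.mem_centralizer_iff.mpr ?_)
      (fun b hb => Subgroup.mem_centralizer_iff.mpr ?_)
    · rintro x (hx | hx)
      · exact hA.1 x hx a ha
      · exact (hAB a ha x hx).symm
    · rintro x (hx | hx)
      · exact hAB x hx b hb
      · exact hB.1 x hx b hb
  have h2 : ∀ x ∈ A ⊔ B, ∀ y ∈ A ⊔ B, x * y = y * x := by
    have h3 : A ⊔ B ≤ Subgroup.centralizer ((A ⊔ B : Subgroup G) : Set G) := by
      refine sup_le (fun a ha => Subgroup.mem_centralizer_iff.mpr fun x hx => ?_)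
        (fun b hb => Subgroup.mem_centralizer_iff.mpr fun x hx => ?_)
      · exact (Subgroup.mem_centralizer_iff.mp (h1 hx) a (Or.inl ha)).symm
      · exact (Subgroup.mem_centralizer_iff.mp (h1 hx) b (Or.inr hb)).symm
    exact fun x hx y hy => Subgroup.mem_centralizer_iff.mp (h3 hy) x hx
  refine ⟨h2, fun x hx => ?_⟩
  rw [Subgroup.sup_eq_closure] at hx h2
  induction hx using Subgroup.closure_induction with
  | mem x hx => exact hx.elim (hA.2 x) (hB.2 x)
  | one => exact one_pow r
  | mul x y hx hy ihx ihy =>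
    rw [Commute.mul_pow (h2 x hx y hy), ihx, ihy, one_mul]
  | inv x hx ih => rw [inv_pow, ih, inv_one]

theorem card_mul_card_le {G : Type*} [Group G] [Finite G] (A B : Subgroup G) :
    Nat.card A * Nat.card B ≤
      Nat.card (A ⊔ B : Subgroup G) * Nat.card (A ⊓ B : Subgroup G) := by
  have h1 := card_inf_mul_relIndex A (A ⊔ B)
  rw [inf_eq_left.mpr le_sup_left] at h1
  have h2 := card_inf_mul_relIndex A B
  have h3 : A.relIndex B ≤ A.relIndex (A ⊔ B) :=
    Subgroup.relIndex_le_of_le_right le_sup_right Subgroup.index_ne_zero_of_finite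
  rw [← h1, ← h2]
  calc Nat.card A * (Nat.card (A ⊓ B : Subgroup G) * A.relIndex B)
      = Nat.card A * A.relIndex B * Nat.card (A ⊓ B : Subgroup G) := by ring
    _ ≤ _ := Nat.mul_le_mul_right _ (Nat.mul_le_mul_left _ h3)

/-- The conjugation action of `S` on a subgroup normalised by `S`. -/
def conjAction {G : Type*} [Group G] (S Y : Subgroup G)
    (h : ∀ s ∈ S, ∀ y ∈ Y, s * y * s⁻¹ ∈ Y) : S →* MulAut Y :=
  restrictMulAut (MulAut.conj.comp S.subtype) Y fun s y hy => h s s.2 y hy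

section

variable {G : Type*} [Group G]

theorem coe_conjAction_apply {S Y : Subgroup G} (h : ∀ s ∈ S, ∀ y ∈ Y, s * y * s⁻¹ ∈ Y)
    (s : S) (y : Y) : (conjAction S Y h s y : G) = s * y * (s : G)⁻¹ := rfl

theorem conjAction_eq_one_iff {S Y : Subgroup G} (h : ∀ s ∈ S, ∀ y ∈ Y, s * y * s⁻¹ ∈ Y)
    (s : S) : conjAction S Y h s = 1 ↔ (s : G) ∈ Subgroup.centralizer (Y : Set G) := by
  rw [Subgroup.mem_centralizer_iff]
  constructor
  · intro h1 y hy
    have h2 := congrArg Subtype.val (DFunLike.congr_fun h1 (⟨y, hy⟩ : Y))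
    rw [coe_conjAction_apply, MulAut.one_apply] at h2
    exact (mul_inv_eq_iff_eq_mul.mp h2).symm
  · intro h1
    ext y
    rw [coe_conjAction_apply, MulAut.one_apply, mul_inv_eq_iff_eq_mul]
    exact (h1 y y.2).symm

theorem IsMaxElemAb.card_commonFixed_le [Finite G] {r : ℕ} {T A Y : Subgroup G}
    (hA : IsMaxElemAb r T A) (hYT : Y ≤ T) (hY : IsElemAb r Y)
    (h : ∀ s ∈ A, ∀ y ∈ Y, s * y * s⁻¹ ∈ Y) {B : Subgroup A} (hB : B.index = r) :
    Nat.card (commonFixed (conjAction A Y h) B) ≤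
      r * Nat.card (commonFixed (conjAction A Y h) ⊤) := by
  set ρ := conjAction A Y h
  set B' := B.map A.subtype with hB'
  set W := (commonFixed ρ B).map Y.subtype with hW
  have hB'A : B' ≤ A := Subgroup.map_subtype_le _
  have hWY : W ≤ Y := Subgroup.map_subtype_le _
  have hcomm : ∀ b ∈ B', ∀ w ∈ W, b * w = w * b := by
    rintro _ ⟨b, hb, rfl⟩ _ ⟨w, hw, rfl⟩
    have := congrArg Subtype.val (hw b hb)
    rw [coe_conjAction_apply] at this
    exact mul_inv_eq_iff_eq_mul.mp this
  have h1 := hA.2.2 (B' ⊔ W) (sup_le (hB'A.trans hA.1) (hWY.trans hYT))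
    ((hA.2.1.mono hB'A).sup (hY.mono hWY) hcomm)
  have h2 := card_mul_card_le B' W
  have h3 : Nat.card (B' ⊓ W : Subgroup G) ≤ Nat.card (commonFixed ρ ⊤) := by
    rw [← Subgroup.card_map_of_injective (K := commonFixed ρ ⊤) Y.subtype_injective]
    refine Subgroup.card_le_of_le ?_
    rintro x ⟨hxB, hxW⟩
    refine ⟨⟨x, hWY hxW⟩, fun a _ => Subtype.ext ?_, rfl⟩
    rw [coe_conjAction_apply, mul_inv_eq_iff_eq_mul]
    exact hA.2.1.1 a a.2 x (hB'A hxB)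
  have h4 : Nat.card B' * r = Nat.card A := by
    rw [hB', Subgroup.card_map_of_injective A.subtype_injective, ← hB, B.card_mul_index]
  have h5 : Nat.card W = Nat.card (commonFixed ρ B) :=
    Subgroup.card_map_of_injective Y.subtype_injective
  rw [← h5]
  have h6 : Nat.card B' * Nat.card W ≤ Nat.card B' * (r * Nat.card (commonFixed ρ ⊤)) :=
    calc Nat.card B' * Nat.card W ≤ Nat.card A * Nat.card (commonFixed ρ ⊤) :=
          h2.trans (Nat.mul_le_mul h1 h3)
      _ = _ := by rw [← h4]; ring
  exact Nat.le_of_mul_le_mul_left h6 Nat.card_pos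

theorem IsMaxElemAb.commute_of_isPGroup [Finite G] {p r : ℕ} (hp : p.Prime) (hp5 : 5 ≤ p)
    (hr : r.Prime) (hpr : r ≠ p) {T A Y : Subgroup G} (hA : IsMaxElemAb r T A) (hYT : Y ≤ T)
    (hY : IsElemAb r Y) (h : ∀ s ∈ A, ∀ y ∈ Y, s * y * s⁻¹ ∈ Y) {R : Subgroup (MulAut Y)}
    (hR : IsPGroup p R)
    (hnorm : ∀ a, ∀ g ∈ R, conjAction A Y h a * g * (conjAction A Y h a)⁻¹ ∈ R) :
    ∀ a, ∀ g ∈ R, conjAction A Y h a * g = g * conjAction A Y h a := by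
  let _ : CommGroup A := { (inferInstance : Group A) with
    mul_comm := fun a b => Subtype.ext (hA.2.1.1 a a.2 b b.2) }
  let _ : CommGroup Y := { (inferInstance : Group Y) with
    mul_comm := fun a b => Subtype.ext (hY.1 a a.2 b b.2) }
  exact commute_of_card_commonFixed_le hp hp5 hr hpr
    (fun a => Subtype.ext (hA.2.1.2 a a.2)) (fun y => Subtype.ext (hY.2 y y.2))
    (conjAction A Y h) hR hnorm fun B hB => hA.card_commonFixed_le hYT hY h hB

end

/-- The central elements of `T` of order dividing `r`. -/
def omegaCenter {G : Type*} [Group G] (r : ℕ) (T : Subgroup G) : Subgroup G where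
  carrier := {y | y ∈ T ∧ (∀ t ∈ T, y * t = t * y) ∧ y ^ r = 1}
  one_mem' := ⟨T.one_mem, fun t _ => by rw [one_mul, mul_one], one_pow r⟩
  mul_mem' := fun {x y} hx hy => ⟨T.mul_mem hx.1 hy.1, fun t ht => by
    rw [mul_assoc, hy.2.1 t ht, ← mul_assoc, hx.2.1 t ht, mul_assoc], by
    rw [Commute.mul_pow (hx.2.1 y hy.1), hx.2.2, hy.2.2, one_mul]⟩
  inv_mem' := fun {x} hx => ⟨T.inv_mem hx.1, fun t ht =>
    (Commute.inv_left (hx.2.1 t ht : Commute x t)).eq, by rw [inv_pow, hx.2.2, inv_one]⟩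

section

variable {G : Type*} [Group G] {r : ℕ} {T : Subgroup G}

theorem omegaCenter_le : omegaCenter r T ≤ T := fun _ h => h.1

theorem isElemAb_omegaCenter : IsElemAb r (omegaCenter r T) :=
  ⟨fun _ hx y hy => hx.2.1 y hy.1, fun _ hx => hx.2.2⟩

theorem conj_mem_omegaCenter {g : G} (hg : g ∈ Subgroup.normalizer (T : Set G)) {y : G}
    (hy : y ∈ omegaCenter r T) : g * y * g⁻¹ ∈ omegaCenter r T := by
  refine ⟨(Subgroup.mem_normalizer_iff.mp hg y).mp hy.1, fun t ht => ?_, ?_⟩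
  · have h1 : g⁻¹ * t * g ∈ T := by
      refine (Subgroup.mem_normalizer_iff.mp hg _).mpr ?_
      convert ht using 1
      group
    have h2 := hy.2.1 _ h1
    calc g * y * g⁻¹ * t = g * (y * (g⁻¹ * t * g)) * g⁻¹ := by group
      _ = g * (g⁻¹ * t * g * y) * g⁻¹ := by rw [h2]
      _ = t * (g * y * g⁻¹) := by group
  · rw [conj_pow, hy.2.2, mul_one, mul_inv_cancel]

end

theorem pow_relIndex_mem {G : Type*} [Group G] {C M : Subgroup G} [C.Normal] {x : G}
    (hx : x ∈ M) : x ^ C.relIndex M ∈ C :=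
  (C.subgroupOf M).pow_index_mem (⟨x, hx⟩ : M)

theorem exists_mul_mem_centralizer_omegaCenter {G : Type*} [Group G] [Finite G]
    [Group.IsSolvable G] {p r a : ℕ}
    (hp : p.Prime) (hp5 : 5 ≤ p) (hr : r.Prime) (hpr : r ≠ p) {H : Subgroup G} (hH : IsCoatom H)
    (hidx : H.index = p ^ a) (T : Sylow r G) {A : Subgroup G}
    (hA : IsMaxElemAb r (T : Subgroup G) A) (hAC : ¬ A ≤ H.normalCore) (g : G) :
    ∃ x ∈ H, ∃ n ∈ Subgroup.centralizer
      (omegaCenter r ((T : Subgroup G) ⊓ H.normalCore) : Set G), x * n = g := by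
  have : Fact r.Prime := ⟨hr⟩
  have : Fact p.Prime := ⟨hp⟩
  set C := H.normalCore with hC
  have hCn : C.Normal := inferInstance
  set T₀ := (T : Subgroup G) ⊓ C with hT₀
  set L := Subgroup.normalizer (T₀ : Set G) with hL
  set Y := omegaCenter r T₀ with hY
  set Z := Subgroup.centralizer (Y : Set G) with hZ
  have hLC : L ⊔ C = ⊤ := normalizer_inf_sup_eq_top hr T C
  have hLY : ∀ s ∈ L, ∀ y ∈ Y, s * y * s⁻¹ ∈ Y := fun s hs y hy => conj_mem_omegaCenter hs hy
  have hTL : (T : Subgroup G) ≤ L := fun t ht => mem_normalizer_of_forall_conj_mem fun x hx =>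
    ⟨(T : Subgroup G).mul_mem ((T : Subgroup G).mul_mem ht hx.1) ((T : Subgroup G).inv_mem ht),
      hCn.conj_mem x hx.2 t⟩
  have hZconj : ∀ l ∈ L, ∀ z ∈ Z, l * z * l⁻¹ ∈ Z := by
    intro l hl z hz
    refine Subgroup.mem_centralizer_iff.mpr fun y hy => ?_
    have h1 := hLY l⁻¹ (L.inv_mem hl) y hy
    have h2 := Subgroup.mem_centralizer_iff.mp hz _ h1
    calc y * (l * z * l⁻¹) = l * (l⁻¹ * y * l⁻¹⁻¹ * z) * l⁻¹ := by group
      _ = l * (z * (l⁻¹ * y * l⁻¹⁻¹)) * l⁻¹ := by rw [h2]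
      _ = l * z * l⁻¹ * y := by group
  by_cases hN : L ⊓ Z ≤ C
  · exfalso
    apply hAC
    obtain ⟨M, hM⟩ := exists_isSocleOver hH
    have hMn := hM.normal
    have hAL : A ≤ L := hA.1.trans hTL
    have hYT : Y ≤ (T : Subgroup G) := omegaCenter_le.trans inf_le_left
    have hAY : ∀ s ∈ A, ∀ y ∈ Y, s * y * s⁻¹ ∈ Y := fun s hs => hLY s (hAL hs)
    have hMC : C.relIndex M = p ^ a := (hM.relIndex_eq hH).trans hidx
    set ρ := conjAction L Y hLY with hρ
    set Mb := (M.subgroupOf L).map ρ with hMb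
    have hr_dvd : ¬ r ∣ Nat.card Mb := by
      have h1 : Nat.card Mb ∣ T₀.relIndex M := by
        rw [hMb, ← Subgroup.relIndex_ker]
        have h2 : T₀.subgroupOf L ≤ ρ.ker := by
          intro t ht
          rw [MonoidHom.mem_ker, hρ, conjAction_eq_one_iff]
          exact Subgroup.mem_centralizer_iff.mpr fun y hy => hy.2.1 t ht
        refine (Subgroup.relIndex_dvd_of_le_left _ h2).trans ?_
        have h3 : (T₀.subgroupOf L).relIndex (M.subgroupOf L) = T₀.relIndex (M ⊓ L) := by
          rw [← Subgroup.inf_subgroupOf_right M, Subgroup.relIndex_subgroupOf inf_le_right]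
        rw [h3]
        exact ⟨_, (Subgroup.relIndex_mul_relIndex T₀ (M ⊓ L) M (le_inf
          (inf_le_right.trans hM.core_le) (inf_le_left.trans hTL)) inf_le_left).symm⟩
      intro h
      have h4 := h.trans h1
      rw [← Subgroup.relIndex_mul_relIndex T₀ C M inf_le_right hM.core_le, hMC, hT₀,
        Subgroup.inf_relIndex_right] at h4
      rcases hr.dvd_mul.mp h4 with h5 | h5
      · exact T.not_dvd_index (h5.trans (relIndex_dvd_index_of_normal_right _ C))
      · exact hpr ((Nat.prime_dvd_prime_iff_eq hr hp).mp (hr.dvd_of_dvd_pow h5))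
    have hρA : ∀ x : A, conjAction A Y hAY x = ρ ⟨x, hAL x.2⟩ := fun x => rfl
    have hMbA : ∀ x : A, ∀ m ∈ Mb, (MulAut.conj.comp (conjAction A Y hAY)) x m ∈ Mb := by
      rintro x _ ⟨m, hm, rfl⟩
      refine ⟨⟨x, hAL x.2⟩ * m * ⟨x, hAL x.2⟩⁻¹, hMn.conj_mem _ hm x, ?_⟩
      rw [map_mul, map_mul, map_inv, ← hρA]
      rfl
    have hAr : IsPGroup r A := T.isPGroup'.to_le hA.1
    obtain ⟨P, hP⟩ := exists_invariant_sylow (p := p) hp hr hAr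
      (restrictMulAut (MulAut.conj.comp (conjAction A Y hAY)) Mb hMbA) hr_dvd
    set R := (P : Subgroup Mb).map Mb.subtype with hR
    have hcomm := hA.commute_of_isPGroup hp hp5 hr hpr hYT isElemAb_omegaCenter hAY
      (R := R) (P.isPGroup'.map _) (by
        rintro x _ ⟨m, hm, rfl⟩
        exact ⟨_, hP x m hm, rfl⟩)
    have hAM : A ≤ M := by
      intro x hx
      let D : Subgroup G :=
        (Subgroup.centralizer {(x : G ⧸ C)}).comap (QuotientGroup.mk' C)
      have hD : ∀ {d}, d ∈ D ↔ ⁅d, x⁆ ∈ C := by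
        intro d
        change (d : G ⧸ C) ∈ Subgroup.centralizer _ ↔ _
        rw [Subgroup.mem_centralizer_singleton_iff, ← commutatorElement_eq_one_iff_mul_comm]
        exact QuotientGroup.eq_one_iff (⁅d, x⁆)
      have hCD : C ≤ D := fun c hc => hD.mpr (by
        rw [commutatorElement_def, mul_assoc, mul_assoc, ← mul_assoc x]
        exact C.mul_mem hc (hCn.conj_mem _ (C.inv_mem hc) x))
      have hQD : R.comap ρ ⊓ M.subgroupOf L ≤ D.subgroupOf L := by
        rintro q ⟨hqR, -⟩
        refine hD.mpr (hN ⟨?_, ?_⟩)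
        · exact (⁅q, (⟨x, hAL hx⟩ : L)⁆).2
        · have h1 := hcomm ⟨x, hx⟩ (ρ q) hqR
          rw [hρA, ← commutatorElement_eq_one_iff_mul_comm, ← map_commutatorElement, hρ,
            conjAction_eq_one_iff] at h1
          have h2 := Z.inv_mem h1
          rw [← commutatorElement_inv]
          exact h2
      have hML : M.subgroupOf L ≤ D.subgroupOf L := by
        rw [← Subgroup.relIndex_eq_one]
        have h1 : (D.subgroupOf L).relIndex (M.subgroupOf L) ∣ (P : Subgroup Mb).index := by
          refine (Subgroup.relIndex_dvd_of_le_left _ hQD).trans ?_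
          rw [Subgroup.inf_relIndex_right, Subgroup.relIndex_comap, ← hMb, hR, Subgroup.relIndex,
            Subgroup.subgroupOf, Subgroup.comap_map_eq_self_of_injective Mb.subtype_injective]
        have h2 : (D.subgroupOf L).relIndex (M.subgroupOf L) ∣ p ^ a := by
          rw [← Subgroup.inf_subgroupOf_right M, Subgroup.relIndex_subgroupOf inf_le_right]
          refine (Subgroup.relIndex_dvd_of_le_left _ hCD).trans ?_
          rw [← Subgroup.relIndex_sup_right, ← hMC]
          exact ⟨_, (Subgroup.relIndex_mul_relIndex C (M ⊓ L ⊔ C) M le_sup_right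
            (sup_le inf_le_left hM.core_le)).symm⟩
        refine Nat.eq_one_of_dvd_coprimes ?_ h1 h2
        exact Nat.Coprime.pow_right a
          ((Nat.Prime.coprime_iff_not_dvd hp).mpr P.not_dvd_index).symm
      refine hM.mem_of_comm x fun m hm => hD.mp ?_
      have hm' : m ∈ L ⊔ C := hLC ▸ Subgroup.mem_top m
      obtain ⟨l, hl, c, hc, rfl⟩ := Subgroup.mem_sup_of_normal_right.mp hm'
      have hlM : l ∈ M := by
        simpa using M.mul_mem hm (M.inv_mem (hM.core_le hc))
      have hlD : l ∈ D := hML (show (⟨l, hl⟩ : L) ∈ M.subgroupOf L from hlM)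
      exact D.mul_mem hlD (hCD hc)
    intro x hx
    have h1 : x ^ p ^ a ∈ C := hMC ▸ pow_relIndex_mem (hAM hx)
    have h2 : x ^ r ^ 1 ∈ C := by
      rw [pow_one, hA.2.1.2 x hx]
      exact C.one_mem
    exact mem_of_pow_mem_of_coprime (Nat.Coprime.pow a 1
      ((Nat.coprime_primes hp hr).mpr (Ne.symm hpr))) h1 h2
  · have hNn : ((L ⊓ Z) ⊔ C).Normal := by
      rw [← Subgroup.normalizer_eq_top_iff, eq_top_iff, ← hLC]
      refine sup_le (fun l hl => ?_) (le_sup_right.trans Subgroup.le_normalizer)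
      refine mem_normalizer_of_forall_conj_mem fun x hx => ?_
      obtain ⟨n, hn, c, hc, rfl⟩ := Subgroup.mem_sup_of_normal_right.mp hx
      have e : l * (n * c) * l⁻¹ = (l * n * l⁻¹) * (l * c * l⁻¹) := by group
      rw [e]
      exact Subgroup.mul_mem_sup ⟨L.mul_mem (L.mul_mem hl hn.1) (L.inv_mem hl),
        hZconj l hl n hn.2⟩ (hCn.conj_mem c hc l)
    have hNH : ¬ (L ⊓ Z) ⊔ C ≤ H := fun h =>
      hN (le_sup_left.trans (Subgroup.normal_le_normalCore.mpr h))
    obtain ⟨n, hn, x, hx, e⟩ := exists_mul_of_not_le hH hNH g⁻¹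
    obtain ⟨z, hz, c, hc, rfl⟩ := Subgroup.mem_sup_of_normal_right.mp hn
    refine ⟨(c * x)⁻¹, H.inv_mem (H.mul_mem (H.normalCore_le hc) hx), z⁻¹, Z.inv_mem hz.2, ?_⟩
    rw [← mul_inv_rev, ← mul_assoc, e, inv_inv]

namespace MaximalBelow

universe u

variable {G : Type u} [Group G] [Finite G] [Group.IsSolvable G] {p a : ℕ} {H : Subgroup G}
  {f : H →* G}

theorem isCoatom_range_of_not_le_normalCore (ih : MaximalBelow.{u} p (Nat.card G)) (hp : p.Prime)
    (hp5 : 5 ≤ p) (hH : IsCoatom H) (hidx : H.index = p ^ a) (hf : Function.Injective f)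
    (hU : pCore p G ≤ H) {r : ℕ} (hr : r.Prime) (hpr : r ≠ p) (T : Sylow r G)
    (hTH : (T : Subgroup G) ≤ H) (hfT : ((T : Subgroup G).subgroupOf H).map f = T)
    (hω : ∃ z ∈ centralPRCore p r (T : Subgroup G), z ≠ 1) {A : Subgroup G}
    (hA : IsMaxElemAb r (T : Subgroup G) A) (hAC : ¬ A ≤ H.normalCore) : IsCoatom f.range := by
  set ω := centralPRCore p r (T : Subgroup G)
  have hωC : ω ⊆ H.normalCore := fun z hz => hz.2.2.2.mem_normalCore hp hr hpr hH hidx hU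
  have hNC : Subgroup.normalClosure ω ≤ H.normalCore := Subgroup.normalClosure_le_normal hωC
  have hNH := hNC.trans H.normalCore_le
  refine ih.isCoatom_range_of_normal hH hidx hf (N := Subgroup.normalClosure ω) ?_ hNH ?_
  · obtain ⟨z, hz, hz1⟩ := hω
    intro h
    exact hz1 (Subgroup.mem_bot.mp (h ▸ Subgroup.subset_normalClosure hz))
  · have h : Subgroup.normalClosure ω ≤ ((Subgroup.normalClosure ω).comap f).map H.subtype := by
      refine (Subgroup.closure_le _).mpr fun w hw => ?_
      obtain ⟨z, hz, hzw⟩ := Group.mem_conjugatesOfSet_iff.mp hw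
      obtain ⟨g, rfl⟩ := isConj_iff.mp hzw
      obtain ⟨x, hx, n, hn, rfl⟩ :=
        exists_mul_mem_centralizer_omegaCenter hp hp5 hr hpr hH hidx T hA hAC g
      have hzΩ : z ∈ omegaCenter r ((T : Subgroup G) ⊓ H.normalCore) :=
        ⟨⟨hz.1, hωC hz⟩, fun t ht => hz.2.1 t ht.1, hz.2.2.1⟩
      have hnz : n * z * n⁻¹ = z := by
        rw [← Subgroup.mem_centralizer_iff.mp hn z hzΩ, mul_inv_cancel_right]
      have hxn : x * n * z * (x * n)⁻¹ = x * z * x⁻¹ := by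
        conv_rhs => rw [← hnz]
        group
      rw [hxn]
      let y : H := ⟨x, hx⟩
      let v : H := ⟨z, hTH hz.1⟩
      refine ⟨y * v * y⁻¹, ?_, rfl⟩
      change f (y * v * y⁻¹) ∈ Subgroup.normalClosure ω
      rw [map_mul, map_mul, map_inv]
      exact Subgroup.normalClosure_normal.conj_mem _ (Subgroup.subset_normalClosure
        (map_mem_centralPRCore hp hr hH hidx hU T hf hTH hfT (x := v) hz)) _
    intro x hx
    obtain ⟨y, hy, hyx⟩ := h hx
    rwa [← Subtype.ext hyx]

theorem isCoatom_range_of_map_sylow_eq (ih : MaximalBelow.{u} p (Nat.card G)) (hp : p.Prime)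
    (hp5 : 5 ≤ p) (hH : IsCoatom H) (hidx : H.index = p ^ a) (hf : Function.Injective f)
    (hU : pCore p G ≤ H) {r : ℕ} (hr : r.Prime) (hpr : r ≠ p)
    (hrU : pCore r (G ⧸ pCore p G) ≠ ⊥) (T : Sylow r G)
    (hTH : (T : Subgroup G) ≤ H) (hfT : ((T : Subgroup G).subgroupOf H).map f = T) :
    IsCoatom f.range := by
  have hω := exists_mem_centralPRCore hr T hrU
  by_cases hJC : thompson r (T : Subgroup G) ≤ H.normalCore
  · obtain ⟨z, hz, hz1⟩ := hω
    exact ih.isCoatom_range_of_thompson_le hH hidx hf hr T hTH hfT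
      (thompson_ne_bot hz.1 hz1 hz.2.2.1) hJC
  · have h : ∃ A, IsMaxElemAb r (T : Subgroup G) A ∧ ¬ A ≤ H.normalCore := by
      contrapose! hJC
      exact sSup_le hJC
    obtain ⟨A, hA, hAC⟩ := h
    exact ih.isCoatom_range_of_not_le_normalCore hp hp5 hH hidx hf hU hr hpr T hTH hfT hω hA hAC

theorem isCoatom_range_of_pCore_le (ih : MaximalBelow.{u} p (Nat.card G)) (hp : p.Prime)
    (hp5 : 5 ≤ p) (hH : IsCoatom H) (hidx : H.index = p ^ a) (hf : Function.Injective f)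
    (hU : pCore p G ≤ H) : IsCoatom f.range := by
  have : Nontrivial (G ⧸ pCore p G) := by
    rw [QuotientGroup.nontrivial_iff]
    intro h
    exact hH.1 (top_le_iff.mp (h ▸ hU))
  obtain ⟨r, hr, hrU⟩ := exists_pCore_ne_bot (G ⧸ pCore p G)
  have hpr : r ≠ p := by
    rintro rfl
    apply hrU
    have hc := characteristic_pCore r (G ⧸ pCore r G)
    have h := comap_mk_pCore_le (Subgroup.normal_of_characteristic _)
      (isPGroup_pCore r (G ⧸ pCore r G))
    rw [eq_bot_iff, ← Subgroup.map_comap_eq_self_of_surjective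
      (QuotientGroup.mk'_surjective (pCore r G)) (pCore r (G ⧸ pCore r G))]
    rintro _ ⟨x, hx, rfl⟩
    exact (QuotientGroup.eq_one_iff x).mpr (h hx)
  have : Fact r.Prime := ⟨hr⟩
  let P : Sylow r H := default
  have hPidx : ((P : Subgroup H).map H.subtype).index = (P : Subgroup H).index * H.index :=
    Subgroup.index_map_subtype _
  have hP : ¬ r ∣ ((P : Subgroup H).map H.subtype).index := by
    rw [hPidx, hidx, hr.dvd_mul, not_or]
    exact ⟨P.not_dvd_index, fun h => hpr ((Nat.prime_dvd_prime_iff_eq hr hp).mp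
      (hr.dvd_of_dvd_pow h))⟩
  let T : Sylow r G := (P.isPGroup'.map H.subtype).toSylow hP
  have hfP : ((P : Subgroup H).map f).index = ((P : Subgroup H).map H.subtype).index := by
    have h1 := ((P : Subgroup H).map f).card_mul_index
    have h2 := ((P : Subgroup H).map H.subtype).card_mul_index
    rw [Subgroup.card_map_of_injective hf] at h1
    rw [Subgroup.card_map_of_injective H.subtype_injective, ← h1] at h2
    exact (Nat.eq_of_mul_eq_mul_left Nat.card_pos h2).symm
  let Q : Sylow r G := (P.isPGroup'.map f).toSylow (hfP ▸ hP)
  obtain ⟨g, hg⟩ := MulAction.exists_smul_eq G Q T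
  have hT : (T : Subgroup G) = (P : Subgroup H).map H.subtype := rfl
  have hfT : ((T : Subgroup G).subgroupOf H).map ((MulAut.conj g).toMonoidHom.comp f) = T := by
    rw [hT, Subgroup.subgroupOf, Subgroup.comap_map_eq_self_of_injective H.subtype_injective,
      ← Subgroup.map_map]
    exact congrArg Sylow.toSubgroup hg
  have h := ih.isCoatom_range_of_map_sylow_eq hp hp5 hH hidx
    ((MulAut.conj g).injective.comp hf) hU hr hpr hrU T (hT ▸ Subgroup.map_subtype_le _) hfT
  rw [MonoidHom.range_comp] at h
  exact (OrderIso.isCoatom_iff (MulAut.conj g).mapSubgroup f.range).mp h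

end MaximalBelow

theorem maximalBelow.{u} {p : ℕ} (hp : p.Prime) (hp5 : 5 ≤ p) (n : ℕ) : MaximalBelow.{u} p n := by
  induction n with
  | zero => intro G X _ _ _ _ i f a h; exact absurd h (Nat.not_lt_zero _)
  | succ n ih =>
    intro G X _ _ _ _ i f a hn hi hf hH hidx
    have ihG : MaximalBelow.{u} p (Nat.card G) := fun G' X _ _ _ _ i f a h =>
      ih G' X i f a (h.trans_le (Nat.lt_succ_iff.mp hn))
    let e : X ≃* i.range := MonoidHom.ofInjective hi
    let φ : i.range →* G := f.comp e.symm.toMonoidHom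
    have hφ : Function.Injective φ := hf.comp e.symm.injective
    have hφr : φ.range = f.range := by
      ext y
      constructor
      · rintro ⟨x, rfl⟩
        exact ⟨e.symm x, rfl⟩
      · rintro ⟨x, rfl⟩
        exact ⟨e x, congrArg f (e.symm_apply_apply x)⟩
    rw [← hφr]
    by_cases hU : pCore p G ≤ i.range
    · exact ihG.isCoatom_range_of_pCore_le hp hp5 hH hidx hφ hU
    · exact ihG.isCoatom_range_of_not_pCore_le hp hH hidx hφ hU

/-- **Remark 2.5.** Let `G` be a finite solvable group, `H` a maximal subgroup of `G` with
`|G : H| = p ^ a` where `p ≥ 5` is prime and `a ≥ 1`, and `K ≤ G` with `K ≅ H`.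
Then `K` is maximal in `G`. -/
theorem maximal_of_index_ge_five
    (G : Type) [Group G] [Finite G] (hG : IsSolvable G)
    (p a : ℕ) (hp : p.Prime) (hp5 : 5 ≤ p) (ha : 0 < a)
    (H : Subgroup G) (hH : IsCoatom H) (hidx : H.index = p ^ a)
    (K : Subgroup G) (hiso : Nonempty (H ≃* K)) :
    IsCoatom K := by
  have : Group.IsSolvable G := hG
  obtain ⟨e⟩ := hiso
  have hr : (K.subtype.comp e.toMonoidHom).range = K := by
    rw [MonoidHom.range_comp, MonoidHom.range_eq_top.mpr e.surjective, ← MonoidHom.range_eq_map,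
      Subgroup.range_subtype]
  have h := maximalBelow hp hp5 (Nat.card G + 1) G H H.subtype (K.subtype.comp e.toMonoidHom) a
    (Nat.lt_succ_self _) H.subtype_injective (K.subtype_injective.comp e.injective)
    (by rwa [Subgroup.range_subtype]) (by rwa [Subgroup.range_subtype])
  rwa [hr] at h
end

section
/- Let G be a finite group, p a prime, and H a maximal subgroup of G with |G : H| = p^n for a positive integer n and with O_{p'}(G) ≤ H. Let S be a Sylow p-subgroup of G such that the product S·O_{p'}(G) is a normal subgroup of G and S is not contained in H. Then (H ∩ S)·O_{p'}(G) is a normal subgroup of G. (Claim established in Case 2 of the proof of Theorem 1.5) -/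
/-- `O_{p'}(G)`: the `p'`-core of `G`, i.e. the largest normal subgroup of `G` whose order is
coprime to `p` (for finite `G` the join of all such normal subgroups is the largest one). -/
def pPrimeCore (p : ℕ) (G : Type*) [Group G] : Subgroup G :=
  sSup {N : Subgroup G | N.Normal ∧ (Nat.card N).Coprime p}

/-- In a finite `p`-group `S`, a subgroup `H` not containing `S` has the property that some element
of `S` outside `H` normalizes `H ⊓ S`. -/
theorem IsPGroup.exists_mem_normalizer_inf_notMem {G : Type*} [Group G] {p : ℕ} [Fact p.Prime]
    {S : Subgroup G} [Finite S] (hS : IsPGroup p S) {H : Subgroup G} (hSH : ¬ S ≤ H) :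
    ∃ s ∈ S, s ∉ H ∧ s ∈ Subgroup.normalizer ((H ⊓ S : Subgroup G) : Set G) := by
  have := hS.isNilpotent
  have hlt : H.subgroupOf S < ⊤ :=
    lt_top_iff_ne_top.2 fun h => hSH (Subgroup.subgroupOf_eq_top.1 h)
  obtain ⟨s, hs, hsH⟩ := SetLike.exists_of_lt (Group.normalizerCondition_of_isNilpotent _ hlt)
  refine ⟨s, s.2, fun h => hsH h, Subgroup.mem_normalizer_iff.2 fun g => ?_⟩
  have hconj : (s : G) * g * (s : G)⁻¹ ∈ S ↔ g ∈ S := by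
    rw [S.mul_mem_cancel_right (S.inv_mem s.2), S.mul_mem_cancel_left s.2]
  simp only [Subgroup.mem_inf, hconj]
  refine and_congr_left fun hg => ?_
  exact Subgroup.mem_normalizer_iff.1 hs ⟨g, hg⟩

theorem pPrimeCore_normal (p : ℕ) (G : Type*) [Group G] : (pPrimeCore p G).Normal :=
  Subgroup.sSup_normal _ fun _ hN => hN.1

/-- Claim from Case 2 of the proof of **Theorem 1.5**.  Let `G` be a finite group, `p` a prime,
`H` a maximal subgroup of `G` with `|G : H| = p ^ n` (`n ≥ 1`) and `O_{p'}(G) ≤ H`.  Let `S` be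
a Sylow `p`-subgroup of `G` such that `S · O_{p'}(G)` is normal in `G` and `S ⊈ H`.  Then
`(H ∩ S) · O_{p'}(G)` is normal in `G`.  (Since `O_{p'}(G)` is normal, the set products
coincide with the joins of subgroups.) -/
theorem inf_sylow_mul_pPrimeCore_normal
    (G : Type) [Group G] [Finite G]
    (p n : ℕ) (hp : p.Prime) (hn : 0 < n)
    (H : Subgroup G) (hH : IsCoatom H) (hidx : H.index = p ^ n)
    (hOH : pPrimeCore p G ≤ H)
    (S : Sylow p G)
    (hnorm : ((S : Subgroup G) ⊔ pPrimeCore p G).Normal)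
    (hSH : ¬ (S : Subgroup G) ≤ H) :
    ((H ⊓ (S : Subgroup G)) ⊔ pPrimeCore p G).Normal := by
  have := Fact.mk hp
  have hK := pPrimeCore_normal p G
  have hD : (H ⊓ (S : Subgroup G)) ⊔ pPrimeCore p G = H ⊓ ((S : Subgroup G) ⊔ pPrimeCore p G) :=
    SetLike.coe_injective <| by
      rw [Subgroup.mul_normal, Subgroup.coe_inf H (_ ⊔ _), Subgroup.mul_normal,
        Subgroup.inf_mul_assoc _ _ _ hOH]
  obtain ⟨s, -, hsH, hs⟩ := S.isPGroup'.exists_mem_normalizer_inf_notMem hSH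
  rw [← Subgroup.normalizer_eq_top_iff]
  refine hH.2 _ (SetLike.lt_iff_le_and_exists.2 ⟨fun h hh => ?_, s, ?_, hsH⟩)
  · rw [hD, Subgroup.mem_normalizer_iff]
    intro g
    simp only [Subgroup.mem_inf]
    rw [H.mul_mem_cancel_right (H.inv_mem hh), H.mul_mem_cancel_left hh, ← hnorm.mem_comm_iff,
      inv_mul_cancel_left]
  · exact Subgroup.normalizer_inf_normalizer_le_normalizer_sup _ _
      ⟨hs, Subgroup.normalizer_eq_top_iff.2 hK ▸ Subgroup.mem_top s⟩
end
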